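/- Let C be a physically reasonable computable measure machine and let T ∈ (0,1). Then the following conditions are equivalent: (1) T is a computable real; (2) at least one of Z_C(T), F_C(T), E_C(T), S_C(T) is a computable real; (3) all of Z_C(T), F_C(T), E_C(T), S_C(T) are computable reals. -/

import Mathlib

open Filter Topology

/-- A set of finite binary strings is prefix-free if no string in it is a
proper prefix of another string in it. -/
def PrefixFree (S : Set (List Bool)) : Prop :=
  ∀ p ∈ S, ∀ q ∈ S, p <+: q → p = q

/-- A computer: a partial recursive function from finite binary strings to
finite binary strings whose domain is a nonempty prefix-free set. -/
structure Computer where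
  f : List Bool →. List Bool
  partrec : Partrec f
  dom_nonempty : f.Dom.Nonempty
  dom_prefixFree : PrefixFree f.Dom

/-- A computer `U` is optimal if for each computer `C` there is `d ∈ ℕ` such
that every `p ∈ Dom C` admits `q` with `U(q) = C(p)` and `|q| ≤ |p| + d`. -/
def Optimal (U : Computer) : Prop :=
  ∀ C : Computer, ∃ d : ℕ, ∀ p ∈ C.f.Dom,
    ∃ q : List Bool, U.f q = C.f p ∧ q.length ≤ p.length + d

/-- `H_C(s)`: the length of a shortest program for `C` printing `s`. -/
noncomputable def complexity (C : Computer) (s : List Bool) : ℕ :=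
  sInf {n | ∃ p : List Bool, s ∈ C.f p ∧ p.length = n}

/-- The `i`-th bit (for `i = 0, 1, 2, …`) of the base-two expansion of
`α - ⌊α⌋` with infinitely many zeros. -/
noncomputable def bitOf (α : ℝ) (i : ℕ) : Bool :=
  decide (⌊(α - ⌊α⌋) * 2 ^ (i + 1)⌋ % 2 = 1)

/-- `α↾n`: the first `n` bits of the base-two expansion of `α - ⌊α⌋`
with infinitely many zeros. -/
noncomputable def firstBits (α : ℝ) (n : ℕ) : List Bool :=
  (List.range n).map (bitOf α)

/-- A real `α` is computable if some total recursive `f : ℕ⁺ → ℚ` satisfies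
`|α - f n| < 1/n` for all `n ≥ 1`. -/
def ComputableReal (α : ℝ) : Prop :=
  ∃ f : ℕ → ℚ, Computable f ∧ ∀ n : ℕ, 0 < n → |α - (f n : ℝ)| < 1 / n

/-- `α` is weakly Chaitin `T`-random (w.r.t. the computer `U`). -/
def WeaklyChaitinTRandom (U : Computer) (T α : ℝ) : Prop :=
  ∃ c : ℕ, ∀ n : ℕ, 0 < n → T * n - c ≤ (complexity U (firstBits α n) : ℝ)

/-- `α` is Chaitin `T`-random (w.r.t. the computer `U`). -/
def ChaitinTRandom (U : Computer) (T α : ℝ) : Prop :=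
  Tendsto (fun n : ℕ => (complexity U (firstBits α n) : ℝ) - T * n) atTop atTop

/-- `α` is `T`-compressible (w.r.t. the computer `U`): `H(α↾n) ≤ Tn + o(n)`. -/
def TCompressible (U : Computer) (T α : ℝ) : Prop :=
  ∃ g : ℕ → ℝ, Tendsto (fun n : ℕ => g n / n) atTop (nhds 0) ∧
    ∀ n : ℕ, 0 < n → (complexity U (firstBits α n) : ℝ) ≤ T * n + g n

/-- The Boltzmann factor `2^(-|p|/T)` of a program `p`. -/
noncomputable def boltzmann (T : ℝ) (p : List Bool) : ℝ :=
  (2 : ℝ) ^ (-(p.length : ℝ) / T)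

/-- Partition function `Z_C(T) = Σ_{p ∈ Dom C} 2^(-|p|/T)`. -/
noncomputable def Zfun (C : Computer) (T : ℝ) : ℝ :=
  ∑' p : C.f.Dom, boltzmann T p.1

/-- Free energy `F_C(T) = -T log₂ Z_C(T)`. -/
noncomputable def Ffun (C : Computer) (T : ℝ) : ℝ :=
  -T * Real.logb 2 (Zfun C T)

/-- Energy `E_C(T) = Z_C(T)⁻¹ Σ_{p ∈ Dom C} |p| 2^(-|p|/T)`. -/
noncomputable def Efun (C : Computer) (T : ℝ) : ℝ :=
  (Zfun C T)⁻¹ * ∑' p : C.f.Dom, (p.1.length : ℝ) * boltzmann T p.1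

/-- Statistical mechanical entropy `S_C(T) = (E_C(T) - F_C(T))/T`. -/
noncomputable def Sfun (C : Computer) (T : ℝ) : ℝ :=
  (Efun C T - Ffun C T) / T

/-- `𝒵(V)`: the set of `T ∈ (0,1)` with `Z_V(T)` computable. -/
def setZ (V : Computer) : Set ℝ := {T | T ∈ Set.Ioo 0 1 ∧ ComputableReal (Zfun V T)}

/-- `ℱ(V)`: the set of `T ∈ (0,1)` with `F_V(T)` computable. -/
def setF (V : Computer) : Set ℝ := {T | T ∈ Set.Ioo 0 1 ∧ ComputableReal (Ffun V T)}

/-- `ℰ(V)`: the set of `T ∈ (0,1)` with `E_V(T)` computable. -/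
def setE (V : Computer) : Set ℝ := {T | T ∈ Set.Ioo 0 1 ∧ ComputableReal (Efun V T)}

/-- `𝒮(V)`: the set of `T ∈ (0,1)` with `S_V(T)` computable. -/
def setS (V : Computer) : Set ℝ := {T | T ∈ Set.Ioo 0 1 ∧ ComputableReal (Sfun V T)}

/-- `FP_w` (w.r.t. the optimal computer `U` fixing `H`): the set of `T ∈ (0,1)`
that are weakly Chaitin `T`-random and `T`-compressible. -/
def FPw (U : Computer) : Set ℝ :=
  {T | T ∈ Set.Ioo 0 1 ∧ WeaklyChaitinTRandom U T T ∧ TCompressible U T T}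

/-- `FP` (w.r.t. the optimal computer `U` fixing `H`): the set of `T ∈ (0,1)`
that are Chaitin `T`-random and `T`-compressible. -/
def FP (U : Computer) : Set ℝ :=
  {T | T ∈ Set.Ioo 0 1 ∧ ChaitinTRandom U T T ∧ TCompressible U T T}

/-- A computer is physically reasonable if its domain contains two strings of
different lengths. -/
def PhysicallyReasonable (C : Computer) : Prop :=
  ∃ p ∈ C.f.Dom, ∃ q ∈ C.f.Dom, p.length ≠ q.length

/-- A computable measure machine: `Z_C(1)` is a computable real. -/
def ComputableMeasureMachine (C : Computer) : Prop :=
  ComputableReal (Zfun C 1)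

/-- `D` is the composition `C₀ ⊘ C₁ ⊘ ⋯ ⊘ C_{N-1}`: its domain consists of the
concatenations `p₀p₁⋯p_{N-1}` with each `pᵢ ∈ Dom Cᵢ`, and on such a
concatenation it returns `C₀(p₀)`. -/
def IsComposition {N : ℕ} (C : Fin N → Computer) (hN : 0 < N) (D : Computer) : Prop :=
  (∀ l, l ∈ D.f.Dom ↔
      ∃ ps : Fin N → List Bool, (∀ i, ps i ∈ (C i).f.Dom) ∧ l = (List.ofFn ps).flatten) ∧
  (∀ ps : Fin N → List Bool, (∀ i, ps i ∈ (C i).f.Dom) →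
      D.f ((List.ofFn ps).flatten) = (C ⟨0, hN⟩).f (ps ⟨0, hN⟩))

/-- A sequence of computers is recursive if a single partial recursive function
uniformly computes all of them. -/
def RecursiveSeq (V : ℕ → Computer) : Prop :=
  ∃ F : ℕ × List Bool →. List Bool, Partrec F ∧ ∀ n p, (V n).f p = F (n, p)

open Encodable

/-! ### Recursively enumerable predicates in primitive recursive normal form -/

def RE {α : Type} [Primcodable α] (p : α → Prop) : Prop :=
  ∃ R : α → ℕ → Prop, PrimrecRel R ∧ ∀ a, p a ↔ ∃ n, R a n

section RE
variable {α β γ : Type} [Primcodable α] [Primcodable β] [Primcodable γ]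

theorem RE.of_eq {p q : α → Prop} (hp : RE p) (h : ∀ a, q a ↔ p a) : RE q := by
  obtain ⟨R, hR, h'⟩ := hp
  exact ⟨R, hR, fun a => (h a).trans (h' a)⟩

theorem RE.of_prim {p : α → Prop} (hp : PrimrecPred p) : RE p :=
  ⟨fun a _ => p a, hp.comp Primrec.fst, fun a => by simp⟩

theorem RE.comp {p : β → Prop} (hp : RE p) {f : α → β} (hf : Primrec f) :
    RE (fun a => p (f a)) := by
  obtain ⟨R, hR, h'⟩ := hp
  exact ⟨fun a n => R (f a) n, PrimrecRel.comp hR (hf.comp Primrec.fst) Primrec.snd,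
    fun a => h' (f a)⟩

theorem RE.or {p q : α → Prop} (hp : RE p) (hq : RE q) : RE (fun a => p a ∨ q a) := by
  obtain ⟨R, hR, h⟩ := hp
  obtain ⟨R', hR', h'⟩ := hq
  refine ⟨fun a n => R a n ∨ R' a n, PrimrecPred.or hR hR', fun a => ?_⟩
  simp only [h, h', exists_or]

theorem RE.and {p q : α → Prop} (hp : RE p) (hq : RE q) : RE (fun a => p a ∧ q a) := by
  obtain ⟨R, hR, h⟩ := hp
  obtain ⟨R', hR', h'⟩ := hq
  refine ⟨fun a n => R a n.unpair.1 ∧ R' a n.unpair.2, PrimrecPred.and ?_ ?_, fun a => ?_⟩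
  · exact PrimrecRel.comp hR Primrec.fst (Primrec.fst.comp (Primrec.unpair.comp Primrec.snd))
  · exact PrimrecRel.comp hR' Primrec.fst (Primrec.snd.comp (Primrec.unpair.comp Primrec.snd))
  · simp only [h, h']
    constructor
    · rintro ⟨⟨n, hn⟩, ⟨m, hm⟩⟩
      exact ⟨Nat.pair n m, by simpa using ⟨hn, hm⟩⟩
    · rintro ⟨n, hn, hm⟩
      exact ⟨⟨_, hn⟩, ⟨_, hm⟩⟩

theorem RE.ex {p : α × β → Prop} (hp : RE p) : RE (fun a => ∃ b, p (a, b)) := by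
  classical
  obtain ⟨R, hR, h⟩ := hp
  have hd : Primrec fun x : (α × β) × ℕ => decide (R x.1 x.2) := by
    have := PrimrecRel.decide hR
    exact this
  refine ⟨fun a n => (Option.casesOn (decode (α := β) n.unpair.1) false
    (fun b => decide (R (a, b) n.unpair.2)) : Bool) = true, ?_, fun a => ?_⟩
  · refine Primrec.primrecPred (p := fun x : α × ℕ => (Option.casesOn (decode (α := β) x.2.unpair.1) false
      (fun b => decide (R (x.1, b) x.2.unpair.2)) : Bool) = true) ?_
    have : Primrec fun x : α × ℕ => (Option.casesOn (decode (α := β) x.2.unpair.1) false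
      (fun b => decide (R (x.1, b) x.2.unpair.2)) : Bool) := by
      refine Primrec.option_casesOn (Primrec.decode.comp
        (Primrec.fst.comp (Primrec.unpair.comp Primrec.snd))) (Primrec.const false) ?_
      refine hd.comp (Primrec.pair (Primrec.pair (Primrec.fst.comp Primrec.fst) Primrec.snd)
        (Primrec.snd.comp (Primrec.unpair.comp (Primrec.snd.comp Primrec.fst))))
    exact this.of_eq fun x => by simp
  · simp only [h]
    constructor
    · rintro ⟨b, n, hn⟩
      exact ⟨Nat.pair (encode b) n, by simpa using hn⟩
    · rintro ⟨n, hn⟩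
      cases hb : decode (α := β) n.unpair.1 with
      | none => simp [hb] at hn
      | some b => exact ⟨b, _, by simpa [hb] using hn⟩

theorem RE.forall_lt {p : α × ℕ → Prop} (hp : RE p) :
    RE (fun x : α × ℕ => ∀ i < x.2, p (x.1, i)) := by
  obtain ⟨R, hR, h⟩ := hp
  refine ⟨fun x n => ∀ i < x.2, ∃ m < n, R (x.1, i) m, ?_, fun x => ?_⟩
  · have h1 : PrimrecRel fun (m : ℕ) (y : α × ℕ) => R y m := PrimrecRel.swap hR
    have h2 : PrimrecRel fun (n : ℕ) (y : α × ℕ) => ∃ m < n, R y m :=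
      (PrimrecRel.comp (PrimrecRel.exists_mem_list h1) (Primrec.list_range.comp Primrec.fst)
        Primrec.snd).of_eq fun n => by simp
    have h3 : PrimrecRel fun (i : ℕ) (z : (α × ℕ) × ℕ) => ∃ m < z.2, R (z.1.1, i) m :=
      PrimrecRel.comp h2 (Primrec.snd.comp Primrec.snd)
        (Primrec.pair (Primrec.fst.comp (Primrec.fst.comp Primrec.snd)) Primrec.fst)
    have h4 : PrimrecRel fun (n : ℕ) (z : (α × ℕ) × ℕ) => ∀ i < n, ∃ m < z.2, R (z.1.1, i) m :=
      (PrimrecRel.comp (PrimrecRel.forall_mem_list h3) (Primrec.list_range.comp Primrec.fst)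
        Primrec.snd).of_eq fun n => by simp
    exact PrimrecRel.comp h4 (Primrec.snd.comp Primrec.fst) Primrec.id
  · simp only [h]
    constructor
    · intro H
      choose! f hf using H
      refine ⟨(Finset.range x.2).sup f + 1, fun i hi => ⟨f i, ?_, hf i hi⟩⟩
      exact Nat.lt_succ_of_le (Finset.le_sup (f := f) (Finset.mem_range.2 hi))
    · rintro ⟨n, hn⟩ i hi
      obtain ⟨m, -, hm⟩ := hn i hi
      exact ⟨m, hm⟩

theorem RE.graph {f : α →. β} (hf : Partrec f) : RE (fun x : α × β => x.2 ∈ f x.1) := by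
  obtain ⟨c, hc⟩ := Nat.Partrec.Code.exists_code.1 hf
  refine ⟨fun x k => Nat.Partrec.Code.evaln k c (encode x.1) = some (encode x.2), ?_, fun x => ?_⟩
  · refine PrimrecRel.comp Primrec.eq (f := fun y : (α × β) × ℕ =>
      Nat.Partrec.Code.evaln y.2 c (encode y.1.1)) ?_ ?_
    · exact Nat.Partrec.Code.primrec_evaln.comp (Primrec.pair (Primrec.pair Primrec.snd
        (Primrec.const c)) (Primrec.encode.comp (Primrec.fst.comp Primrec.fst)))
    · exact Primrec.option_some.comp (Primrec.encode.comp (Primrec.snd.comp Primrec.fst))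
  · have : encode x.2 ∈ Nat.Partrec.Code.eval c (encode x.1) ↔ x.2 ∈ f x.1 := by
      rw [hc]; simp
    refine this.symm.trans (Nat.Partrec.Code.evaln_complete.trans ?_)
    rfl

theorem RE.comp_computable {p : β → Prop} (hp : RE p) {f : α → β} (hf : Computable f) :
    RE (fun a => p (f a)) := by
  have h1 : RE (fun x : α × β => x.2 ∈ (f : α →. β) x.1) := RE.graph hf
  refine (RE.ex (h1.and (hp.comp Primrec.snd))).of_eq fun a => ?_
  simp

theorem RE.dom {f : α →. β} (hf : Partrec f) : RE (fun x : α => x ∈ f.Dom) := by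
  refine (RE.ex (RE.graph hf)).of_eq fun a => ?_
  simp [PFun.mem_dom]

theorem RE.choose {p : α × β → Prop} (hp : RE p) (ht : ∀ a, ∃ b, p (a, b)) :
    ∃ f : α → β, Computable f ∧ ∀ a, p (a, f a) := by
  classical
  obtain ⟨R, hR, h⟩ := hp
  have hd : Primrec fun x : (α × β) × ℕ => decide (R x.1 x.2) := PrimrecRel.decide hR
  let g : α → ℕ → Option β := fun a n => (decode (α := β) n.unpair.1).bind
    (fun b => bif decide (R (a, b) n.unpair.2) then some b else none)
  have hg : Primrec₂ g := by
    refine Primrec.option_bind (Primrec.decode.comp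
        (Primrec.fst.comp (Primrec.unpair.comp Primrec.snd))) ?_
    refine Primrec.cond (hd.comp (Primrec.pair (Primrec.pair (Primrec.fst.comp Primrec.fst) Primrec.snd)
        (Primrec.snd.comp (Primrec.unpair.comp (Primrec.snd.comp Primrec.fst))))) ?_ (Primrec.const _)
    exact Primrec.option_some.comp Primrec.snd
  have key : ∀ a n b, g a n = some b → p (a, b) := by
    intro a n b hb
    simp only [g, Option.bind_eq_some_iff] at hb
    obtain ⟨b', hb', h2⟩ := hb
    rw [h]
    by_cases hh : R (a, b') n.unpair.2
    · simp [hh] at h2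
      subst h2
      exact ⟨_, hh⟩
    · simp [hh] at h2
  have hpart : Partrec fun a => Nat.rfindOpt (g a) := Partrec.rfindOpt hg.to_comp
  have hdom : ∀ a, (Nat.rfindOpt (g a)).Dom := by
    intro a
    rw [Nat.rfindOpt_dom]
    obtain ⟨b, hb⟩ := ht a
    obtain ⟨n, hn⟩ := (h _).1 hb
    exact ⟨Nat.pair (encode b) n, b, by simp [g, hn]⟩
  refine ⟨fun a => (Nat.rfindOpt (g a)).get (hdom a), ?_, fun a => ?_⟩
  · exact hpart.of_eq fun a => by simp
  · obtain ⟨n, hn⟩ := Nat.rfindOpt_spec (Part.get_mem (hdom a))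
    exact key a n _ hn

end RE

/-! ### Rational valued primitive recursive functions -/

/-- The rational coded by a triple. -/
noncomputable def Qv (t : ℕ × ℕ × ℕ) : ℝ := ((t.1 : ℝ) - t.2.1) / (t.2.2 + 1)

theorem Qv_surj (q : ℚ) : ∃ t, Qv t = q := by
  refine ⟨(q.num.toNat, (-q.num).toNat, q.den - 1), ?_⟩
  have h1 : ((q.num.toNat : ℝ) - ((-q.num).toNat : ℝ)) = (q.num : ℝ) := by
    have : ((q.num.toNat : ℤ) - ((-q.num).toNat : ℤ)) = q.num := by omega
    exact_mod_cast this
  have h2 : (((q.den - 1 : ℕ) : ℝ) + 1) = q.den := by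
    have := q.den_pos
    have : (q.den - 1) + 1 = q.den := by omega
    exact_mod_cast this
  simp only [Qv]
  rw [h1, h2]
  exact (Rat.cast_def q).symm

theorem Qv_between {x y : ℝ} (h : x < y) : ∃ t, x < Qv t ∧ Qv t < y := by
  obtain ⟨q, h1, h2⟩ := exists_rat_btwn h
  obtain ⟨t, ht⟩ := Qv_surj q
  exact ⟨t, by rw [ht]; exact ⟨h1, h2⟩⟩

def RC {α : Type} [Primcodable α] (f : α → ℝ) : Prop :=
  ∃ g : α → ℕ × ℕ × ℕ, Primrec g ∧ ∀ a, f a = Qv (g a)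

def addQ (s t : ℕ × ℕ × ℕ) : ℕ × ℕ × ℕ :=
  (s.1 * (t.2.2 + 1) + t.1 * (s.2.2 + 1), s.2.1 * (t.2.2 + 1) + t.2.1 * (s.2.2 + 1),
    s.2.2 * t.2.2 + s.2.2 + t.2.2)

def mulQ (s t : ℕ × ℕ × ℕ) : ℕ × ℕ × ℕ :=
  (s.1 * t.1 + s.2.1 * t.2.1, s.1 * t.2.1 + s.2.1 * t.1,
    s.2.2 * t.2.2 + s.2.2 + t.2.2)

theorem Qv_add (s t) : Qv (addQ s t) = Qv s + Qv t := by
  simp only [Qv, addQ]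
  push_cast
  have h1 : (s.2.2 : ℝ) + 1 ≠ 0 := by positivity
  have h2 : (t.2.2 : ℝ) + 1 ≠ 0 := by positivity
  have h3 : (s.2.2 : ℝ) * t.2.2 + s.2.2 + t.2.2 + 1 ≠ 0 := by positivity
  field_simp
  ring

theorem Qv_mul (s t) : Qv (mulQ s t) = Qv s * Qv t := by
  simp only [Qv, mulQ]
  push_cast
  have h1 : (s.2.2 : ℝ) + 1 ≠ 0 := by positivity
  have h2 : (t.2.2 : ℝ) + 1 ≠ 0 := by positivity
  have h3 : (s.2.2 : ℝ) * t.2.2 + s.2.2 + t.2.2 + 1 ≠ 0 := by positivity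
  field_simp
  ring

theorem Qv_neg (a b c) : Qv (b, a, c) = - Qv (a, b, c) := by
  simp only [Qv]; ring

section RC
variable {α β γ : Type} [Primcodable α] [Primcodable β] [Primcodable γ]

open Primrec in
theorem primrec_addQ : Primrec₂ addQ := by
  have s : Primrec fun x : (ℕ × ℕ × ℕ) × (ℕ × ℕ × ℕ) => x.1 := fst
  have t : Primrec fun x : (ℕ × ℕ × ℕ) × (ℕ × ℕ × ℕ) => x.2 := snd
  have s1 := fst.comp s
  have t1 := fst.comp t
  have s2 := fst.comp (snd.comp s)
  have t2 := fst.comp (snd.comp t)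
  have s3 := snd.comp (snd.comp s)
  have t3 := snd.comp (snd.comp t)
  exact pair (nat_add.comp (nat_mul.comp s1 (succ.comp t3)) (nat_mul.comp t1 (succ.comp s3)))
    (pair (nat_add.comp (nat_mul.comp s2 (succ.comp t3)) (nat_mul.comp t2 (succ.comp s3)))
      (nat_add.comp (nat_add.comp (nat_mul.comp s3 t3) s3) t3))

open Primrec in
theorem primrec_mulQ : Primrec₂ mulQ := by
  have s : Primrec fun x : (ℕ × ℕ × ℕ) × (ℕ × ℕ × ℕ) => x.1 := fst
  have t : Primrec fun x : (ℕ × ℕ × ℕ) × (ℕ × ℕ × ℕ) => x.2 := snd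
  have s1 := fst.comp s
  have t1 := fst.comp t
  have s2 := fst.comp (snd.comp s)
  have t2 := fst.comp (snd.comp t)
  have s3 := snd.comp (snd.comp s)
  have t3 := snd.comp (snd.comp t)
  exact pair (nat_add.comp (nat_mul.comp s1 t1) (nat_mul.comp s2 t2))
    (pair (nat_add.comp (nat_mul.comp s1 t2) (nat_mul.comp s2 t1))
      (nat_add.comp (nat_add.comp (nat_mul.comp s3 t3) s3) t3))

theorem RC.of_eq {f g : α → ℝ} (hf : RC f) (h : ∀ a, g a = f a) : RC g := by
  obtain ⟨u, hu, h'⟩ := hf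
  exact ⟨u, hu, fun a => (h a).trans (h' a)⟩

theorem RC.comp {f : β → ℝ} (hf : RC f) {g : α → β} (hg : Primrec g) : RC (fun a => f (g a)) := by
  obtain ⟨u, hu, h'⟩ := hf
  exact ⟨fun a => u (g a), hu.comp hg, fun a => h' _⟩

theorem RC.val {f : α → ℕ × ℕ × ℕ} (hf : Primrec f) : RC (fun a => Qv (f a)) :=
  ⟨f, hf, fun _ => rfl⟩

theorem RC.add {f g : α → ℝ} (hf : RC f) (hg : RC g) : RC (fun a => f a + g a) := by
  obtain ⟨u, hu, h⟩ := hf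
  obtain ⟨v, hv, h'⟩ := hg
  exact ⟨fun a => addQ (u a) (v a), primrec_addQ.comp hu hv, fun a => by simp only [Qv_add, h, h']⟩

theorem RC.mul {f g : α → ℝ} (hf : RC f) (hg : RC g) : RC (fun a => f a * g a) := by
  obtain ⟨u, hu, h⟩ := hf
  obtain ⟨v, hv, h'⟩ := hg
  exact ⟨fun a => mulQ (u a) (v a), primrec_mulQ.comp hu hv, fun a => by simp only [Qv_mul, h, h']⟩

theorem RC.neg {f : α → ℝ} (hf : RC f) : RC (fun a => - f a) := by
  obtain ⟨u, hu, h⟩ := hf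
  exact ⟨fun a => ((u a).2.1, (u a).1, (u a).2.2), Primrec.pair
    (Primrec.fst.comp (Primrec.snd.comp hu)) (Primrec.pair (Primrec.fst.comp hu)
      (Primrec.snd.comp (Primrec.snd.comp hu))), fun a => (congrArg Neg.neg (h a)).trans (Qv_neg _ _ _).symm⟩

theorem RC.sub {f g : α → ℝ} (hf : RC f) (hg : RC g) : RC (fun a => f a - g a) :=
  (hf.add hg.neg).of_eq fun _ => sub_eq_add_neg _ _

theorem RC.nat {f : α → ℕ} (hf : Primrec f) : RC (fun a => (f a : ℝ)) :=
  ⟨fun a => (f a, 0, 0), Primrec.pair hf (Primrec.const _), fun a => by simp [Qv]⟩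

theorem RC.natc (n : ℕ) : RC (fun _ : α => (n : ℝ)) := RC.nat (Primrec.const n)

theorem RC.zero : RC (fun _ : α => (0 : ℝ)) := (RC.natc 0).of_eq fun _ => by simp

theorem RC.one : RC (fun _ : α => (1 : ℝ)) := (RC.natc 1).of_eq fun _ => by simp

theorem RC.two : RC (fun _ : α => (2 : ℝ)) := (RC.natc 2).of_eq fun _ => by simp

theorem RC.inv_succ {f : α → ℕ} (hf : Primrec f) : RC (fun a => 1 / ((f a : ℝ) + 1)) :=
  ⟨fun a => (1, 0, f a), Primrec.pair (Primrec.const _) (Primrec.pair (Primrec.const _) hf),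
    fun a => by simp [Qv]⟩

theorem RC.pow {f : α → ℝ} (hf : RC f) {k : α → ℕ} (hk : Primrec k) : RC (fun a => f a ^ k a) := by
  obtain ⟨u, hu, h⟩ := hf
  refine ⟨fun a => Nat.rec (1, 0, 0) (fun _ r => mulQ r (u a)) (k a), ?_, fun a => ?_⟩
  · have : Primrec fun x : α × (ℕ × (ℕ × ℕ × ℕ)) => mulQ x.2.2 (u x.1) :=
      primrec_mulQ.comp (Primrec.snd.comp Primrec.snd) (hu.comp Primrec.fst)
    exact Primrec.nat_rec' (h := fun a x => mulQ x.2 (u a)) hk (Primrec.const _) this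
  · simp only [h]
    generalize k a = n
    induction n with
    | zero => simp [Qv]
    | succ n ih => simp only [Qv_mul, ← ih, pow_succ]

theorem RC.list_sum {l : α → List (ℕ × ℕ × ℕ)} (hl : Primrec l) :
    RC (fun a => ((l a).map Qv).sum) := by
  refine ⟨fun a => (l a).foldr addQ (0, 0, 0), ?_, fun a => ?_⟩
  · have : Primrec fun x : α × ((ℕ × ℕ × ℕ) × (ℕ × ℕ × ℕ)) => addQ x.2.1 x.2.2 :=
      primrec_addQ.comp (Primrec.fst.comp Primrec.snd) (Primrec.snd.comp Primrec.snd)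
    exact Primrec.list_foldr (h := fun _ x => addQ x.1 x.2) hl (Primrec.const _) this
  · simp only
    generalize l a = m
    induction m with
    | nil => simp [Qv]
    | cons x m ih => simp only [List.map_cons, List.sum_cons, List.foldr_cons, Qv_add, ih]

open Primrec in
theorem RC.lt_prim {f g : α → ℝ} (hf : RC f) (hg : RC g) : PrimrecPred (fun a => f a < g a) := by
  obtain ⟨s, hs, h⟩ := hf
  obtain ⟨t, ht, h'⟩ := hg
  have s1 := fst.comp hs
  have t1 := fst.comp ht
  have s2 := fst.comp (snd.comp hs)
  have t2 := fst.comp (snd.comp ht)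
  have s3 := snd.comp (snd.comp hs)
  have t3 := snd.comp (snd.comp ht)
  have := PrimrecRel.comp nat_lt
    (nat_add.comp (nat_mul.comp s1 (succ.comp t3)) (nat_mul.comp t2 (succ.comp s3)))
    (nat_add.comp (nat_mul.comp t1 (succ.comp s3)) (nat_mul.comp s2 (succ.comp t3)))
  refine this.of_eq fun a => ?_
  rw [h, h', Qv, Qv, div_lt_div_iff₀ (by positivity) (by positivity), ← Nat.cast_lt (α := ℝ)]
  push_cast
  constructor <;> intro h <;> linarith

theorem RC.lt {f g : α → ℝ} (hf : RC f) (hg : RC g) : RE (fun a => f a < g a) :=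
  RE.of_prim (hf.lt_prim hg)

theorem RC.eq {f g : α → ℝ} (hf : RC f) (hg : RC g) : RE (fun a => f a = g a) :=
  (RE.of_prim ((hf.lt_prim hg).not.and (hg.lt_prim hf).not)).of_eq fun a => by
    rw [not_lt, not_lt, and_comm, le_antisymm_iff]

/-! ### Lower semicomputable families of reals -/

def L (f : α → ℝ) : Prop := RE (fun x : α × (ℕ × ℕ × ℕ) => Qv x.2 < f x.1)

theorem L.of_eq {f g : α → ℝ} (hf : L f) (h : ∀ a, g a = f a) : L g := by
  have : g = f := funext h
  rwa [this]

theorem L.comp {f : β → ℝ} (hf : L f) {g : α → β} (hg : Primrec g) : L (fun a => f (g a)) :=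
  RE.comp hf (Primrec.pair (hg.comp Primrec.fst) Primrec.snd)

theorem L.lt {f r : α → ℝ} (hf : L f) (hr : RC r) : RE (fun a => r a < f a) := by
  obtain ⟨u, hu, h⟩ := hr
  refine (RE.comp hf (Primrec.pair Primrec.id hu)).of_eq fun a => ?_
  simp [h]

theorem RC.L {f : α → ℝ} (hf : RC f) : L f :=
  RC.lt (RC.val Primrec.snd) (hf.comp Primrec.fst)

theorem L.add {f g : α → ℝ} (hf : L f) (hg : L g) : L (fun a => f a + g a) := by
  have h1 : RE fun x : (α × (ℕ × ℕ × ℕ)) × (ℕ × ℕ × ℕ) => Qv x.2 < f x.1.1 :=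
    (hf.comp (Primrec.fst.comp Primrec.fst)).lt (RC.val Primrec.snd)
  have h2 : RE fun x : (α × (ℕ × ℕ × ℕ)) × (ℕ × ℕ × ℕ) => Qv x.1.2 - Qv x.2 < g x.1.1 :=
    (hg.comp (Primrec.fst.comp Primrec.fst)).lt
      ((RC.val (Primrec.snd.comp Primrec.fst)).sub (RC.val Primrec.snd))
  refine (RE.ex (h1.and h2)).of_eq fun x => ?_
  constructor
  · intro h
    obtain ⟨t, ht, ht'⟩ := Qv_between (show Qv x.2 - g x.1 < f x.1 by linarith)
    exact ⟨t, ht', by simp only; linarith⟩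
  · rintro ⟨t, h1, h2⟩
    simp only at h1 h2
    linarith

theorem L.rc_mul {f r : α → ℝ} (hf : L f) (hr : RC r) (h0 : ∀ a, 0 ≤ r a) :
    L (fun a => r a * f a) := by
  have h1 : RE fun x : (α × (ℕ × ℕ × ℕ)) × (ℕ × ℕ × ℕ) => Qv x.2 < f x.1.1 :=
    (hf.comp (Primrec.fst.comp Primrec.fst)).lt (RC.val Primrec.snd)
  have h2 : RE fun x : (α × (ℕ × ℕ × ℕ)) × (ℕ × ℕ × ℕ) => Qv x.1.2 < r x.1.1 * Qv x.2 :=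
    RC.lt (RC.val (Primrec.snd.comp Primrec.fst))
      ((hr.comp (Primrec.fst.comp Primrec.fst)).mul (RC.val Primrec.snd))
  refine (RE.ex (h1.and h2)).of_eq fun x => ?_
  constructor
  · intro h
    rcases (h0 x.1).eq_or_lt with h3 | h3
    · obtain ⟨t, -, ht'⟩ := Qv_between (show f x.1 - 1 < f x.1 by linarith)
      refine ⟨t, ht', ?_⟩
      simp only [← h3, zero_mul] at h ⊢
      exact h
    · have : Qv x.2 / r x.1 < f x.1 := by rw [div_lt_iff₀ h3]; linarith
      obtain ⟨t, ht, ht'⟩ := Qv_between this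
      refine ⟨t, ht', ?_⟩
      rw [div_lt_iff₀ h3] at ht
      simp only; linarith
  · rintro ⟨t, h1, h2⟩
    simp only at h1 h2
    exact lt_of_lt_of_le h2 (mul_le_mul_of_nonneg_left h1.le (h0 _))

theorem L.mul_pos {f g : α → ℝ} (hf : L f) (hg : L g) (f0 : ∀ a, 0 < f a) (g0 : ∀ a, 0 < g a) :
    L (fun a => f a * g a) := by
  have h1 : RE fun x : (α × (ℕ × ℕ × ℕ)) × ((ℕ × ℕ × ℕ) × (ℕ × ℕ × ℕ)) => Qv x.2.1 < f x.1.1 :=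
    (hf.comp (Primrec.fst.comp Primrec.fst)).lt (RC.val (Primrec.fst.comp Primrec.snd))
  have h2 : RE fun x : (α × (ℕ × ℕ × ℕ)) × ((ℕ × ℕ × ℕ) × (ℕ × ℕ × ℕ)) => Qv x.2.2 < g x.1.1 :=
    (hg.comp (Primrec.fst.comp Primrec.fst)).lt (RC.val (Primrec.snd.comp Primrec.snd))
  have h3 : RE fun x : (α × (ℕ × ℕ × ℕ)) × ((ℕ × ℕ × ℕ) × (ℕ × ℕ × ℕ)) => 0 < Qv x.2.1 :=
    RC.lt RC.zero (RC.val (Primrec.fst.comp Primrec.snd))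
  have h4 : RE fun x : (α × (ℕ × ℕ × ℕ)) × ((ℕ × ℕ × ℕ) × (ℕ × ℕ × ℕ)) => 0 < Qv x.2.2 :=
    RC.lt RC.zero (RC.val (Primrec.snd.comp Primrec.snd))
  have h5 : RE fun x : (α × (ℕ × ℕ × ℕ)) × ((ℕ × ℕ × ℕ) × (ℕ × ℕ × ℕ)) =>
      Qv x.1.2 < Qv x.2.1 * Qv x.2.2 :=
    RC.lt (RC.val (Primrec.snd.comp Primrec.fst))
      ((RC.val (Primrec.fst.comp Primrec.snd)).mul (RC.val (Primrec.snd.comp Primrec.snd)))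
  refine (RE.ex (h1.and (h2.and (h3.and (h4.and h5))))).of_eq fun x => ?_
  constructor
  · intro h
    have : max 0 (Qv x.2 / g x.1) < f x.1 := by
      rw [max_lt_iff, div_lt_iff₀ (g0 _)]
      exact ⟨f0 _, h⟩
    obtain ⟨t, ht, ht'⟩ := Qv_between this
    rw [max_lt_iff, div_lt_iff₀ (g0 _)] at ht
    have : max 0 (Qv x.2 / Qv t) < g x.1 := by
      rw [max_lt_iff, div_lt_iff₀ ht.1]
      exact ⟨g0 _, by linarith [ht.2]⟩
    obtain ⟨u, hu, hu'⟩ := Qv_between this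
    rw [max_lt_iff, div_lt_iff₀ ht.1] at hu
    exact ⟨(t, u), ht', hu', ht.1, hu.1, by simp only; linarith [hu.2]⟩
  · rintro ⟨⟨t, u⟩, h1, h2, h3, h4, h5⟩
    simp only at h1 h2 h3 h4 h5
    exact h5.trans (mul_lt_mul'' h1 h2 h3.le h4.le)

theorem L.inv {f : α → ℝ} (hf : L (fun a => - f a)) (f0 : ∀ a, 0 < f a) :
    L (fun a => (f a)⁻¹) := by
  have h1 : RE fun x : (α × (ℕ × ℕ × ℕ)) × (ℕ × ℕ × ℕ) => Qv x.2 < - f x.1.1 :=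
    (hf.comp (Primrec.fst.comp Primrec.fst)).lt (RC.val Primrec.snd)
  have h2 : RE fun x : (α × (ℕ × ℕ × ℕ)) × (ℕ × ℕ × ℕ) => Qv x.1.2 * (- Qv x.2) < 1 :=
    RC.lt ((RC.val (Primrec.snd.comp Primrec.fst)).mul (RC.val Primrec.snd).neg) RC.one
  refine (RE.ex (h1.and h2)).of_eq fun x => ?_
  have hf0 := f0 x.1
  constructor
  · intro h
    simp only at h
    rcases le_or_gt (Qv x.2) 0 with h3 | h3
    · obtain ⟨t, ht, ht'⟩ := Qv_between (show - f x.1 - 1 < - f x.1 by linarith)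
      refine ⟨t, ht', ?_⟩
      simp only
      nlinarith
    · rw [lt_inv_comm₀ h3 hf0] at h
      obtain ⟨t, ht, ht'⟩ := Qv_between (neg_lt_neg h)
      refine ⟨t, ht', ?_⟩
      simp only
      have h4 : - Qv t < (Qv x.2)⁻¹ := by linarith
      rw [← one_div, lt_div_iff₀ h3] at h4
      linarith
  · rintro ⟨t, h1, h2⟩
    simp only at h1 h2 ⊢
    have ht : 0 < - Qv t := by linarith
    have : Qv x.2 < (- Qv t)⁻¹ := by rwa [← one_div, lt_div_iff₀ ht]
    exact this.trans_le (inv_anti₀ hf0 (by linarith))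

theorem L.neg_inv {f : α → ℝ} (hf : L f) (f0 : ∀ a, 0 < f a) :
    L (fun a => - (f a)⁻¹) := by
  have h1 : RE fun x : (α × (ℕ × ℕ × ℕ)) × (ℕ × ℕ × ℕ) => Qv x.2 < f x.1.1 :=
    (hf.comp (Primrec.fst.comp Primrec.fst)).lt (RC.val Primrec.snd)
  have h2 : RE fun x : (α × (ℕ × ℕ × ℕ)) × (ℕ × ℕ × ℕ) => 1 < (- Qv x.1.2) * Qv x.2 :=
    RC.lt RC.one ((RC.val (Primrec.snd.comp Primrec.fst)).neg.mul (RC.val Primrec.snd))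
  have h3 : RE fun x : (α × (ℕ × ℕ × ℕ)) × (ℕ × ℕ × ℕ) => 0 < Qv x.2 :=
    RC.lt RC.zero (RC.val Primrec.snd)
  refine (RE.ex (h1.and (h2.and h3))).of_eq fun x => ?_
  have hf0 := f0 x.1
  constructor
  · intro h
    have h4 : (f x.1)⁻¹ < - Qv x.2 := by linarith
    have h5 : 0 < - Qv x.2 := (inv_pos.2 hf0).trans h4
    rw [inv_lt_comm₀ hf0 h5] at h4
    obtain ⟨t, ht, ht'⟩ := Qv_between h4
    have h6 : 0 < Qv t := (inv_pos.2 h5).trans ht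
    refine ⟨t, ht', ?_, h6⟩
    rw [← one_div, div_lt_iff₀ h5] at ht
    simp only; linarith
  · rintro ⟨t, h1, h2, h3⟩
    simp only at h1 h2 h3 ⊢
    have : (Qv t)⁻¹ < - Qv x.2 := by rwa [← one_div, div_lt_iff₀ h3]
    have := (inv_anti₀ h3 h1.le)
    linarith

theorem L.logb {f : α → ℝ} (hf : L f) (f0 : ∀ a, 0 < f a) :
    L (fun a => Real.logb 2 (f a)) := by
  have h1 : RE fun x : (α × (ℕ × ℕ × ℕ)) × (ℕ × ℕ × ℕ) => Qv x.2 < f x.1.1 :=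
    (hf.comp (Primrec.fst.comp Primrec.fst)).lt (RC.val Primrec.snd)
  have q : Primrec fun x : (α × (ℕ × ℕ × ℕ)) × (ℕ × ℕ × ℕ) => x.1.2 :=
    Primrec.snd.comp Primrec.fst
  have h2 : RE fun x : (α × (ℕ × ℕ × ℕ)) × (ℕ × ℕ × ℕ) =>
      (2 : ℝ) ^ x.1.2.1 < Qv x.2 ^ (x.1.2.2.2 + 1) * 2 ^ x.1.2.2.1 :=
    RC.lt (RC.two.pow (Primrec.fst.comp q))
      (((RC.val Primrec.snd).pow (Primrec.succ.comp (Primrec.snd.comp (Primrec.snd.comp q)))).mul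
        (RC.two.pow (Primrec.fst.comp (Primrec.snd.comp q))))
  have h3 : RE fun x : (α × (ℕ × ℕ × ℕ)) × (ℕ × ℕ × ℕ) => 0 < Qv x.2 :=
    RC.lt RC.zero (RC.val Primrec.snd)
  refine (RE.ex (h1.and (h2.and h3))).of_eq fun x => ?_
  have hf0 := f0 x.1
  have key : ∀ z : ℝ, 0 < z → (Qv x.2 < Real.logb 2 z ↔
      (2 : ℝ) ^ x.2.1 < z ^ (x.2.2.2 + 1) * 2 ^ x.2.2.1) := by
    intro z hz
    rw [← Real.logb_lt_logb_iff (b := 2) (x := (2 : ℝ) ^ x.2.1) (by norm_num)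
      (by positivity) (by positivity), Real.logb_mul (by positivity) (by positivity), Real.logb_pow, Real.logb_pow, Real.logb_pow,
      Real.logb_self_eq_one (by norm_num), Qv, div_lt_iff₀ (by positivity)]
    push_cast
    constructor <;> intro h <;> linarith
  constructor
  · intro h
    have h' : (2 : ℝ) ^ Qv x.2 < f x.1 := (Real.lt_logb_iff_rpow_lt (by norm_num) hf0).1 h
    obtain ⟨t, ht, ht'⟩ := Qv_between h'
    have h6 : 0 < Qv t := (Real.rpow_pos_of_pos (by norm_num) _).trans ht
    exact ⟨t, ht', (key _ h6).1 ((Real.lt_logb_iff_rpow_lt (by norm_num) h6).2 ht), h6⟩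
  · rintro ⟨t, h1, h2, h3⟩
    exact ((key _ h3).2 h2).trans (Real.logb_lt_logb (by norm_num) h3 h1)

theorem L.neg_logb {f : α → ℝ} (hf : L (fun a => - f a)) (f0 : ∀ a, 0 < f a) :
    L (fun a => - Real.logb 2 (f a)) :=
  (L.logb (L.inv hf f0) (fun a => inv_pos.2 (f0 a))).of_eq fun _ => (Real.logb_inv _ _).symm

theorem L.root {f ρ : α → ℝ} {d : α → ℕ} (f0 : ∀ a, 0 < f a) (hρ : RC ρ) (hd : Primrec d)
    (h : ∀ a, f a ^ (d a + 1) = ρ a) : L f ∧ L (fun a => - f a) := by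
  have hv : RC fun x : α × (ℕ × ℕ × ℕ) => Qv x.2 := RC.val Primrec.snd
  have hd' : Primrec fun x : α × (ℕ × ℕ × ℕ) => d x.1 + 1 :=
    Primrec.succ.comp (hd.comp Primrec.fst)
  constructor
  · refine ((RC.lt hv RC.zero).or (RC.lt (hv.pow hd') (hρ.comp Primrec.fst))).of_eq fun x => ?_
    have := f0 x.1
    rw [← h]
    rcases lt_or_ge (Qv x.2) 0 with h0 | h0
    · simp [h0, h0.trans this]
    · rw [pow_lt_pow_iff_left₀ h0 this.le (by omega)]
      simp [not_lt.2 h0]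
  · refine ((RC.lt hv RC.zero).and (RC.lt (hρ.comp Primrec.fst) (hv.neg.pow hd'))).of_eq fun x => ?_
    have := f0 x.1
    rw [← h]
    rcases lt_or_ge (Qv x.2) 0 with h0 | h0
    · rw [pow_lt_pow_iff_left₀ this.le (by linarith) (by omega), lt_neg]
      simp [h0]
    · simp only [not_lt.2 h0, false_and, iff_false]
      linarith

theorem L.tsum {f : α × ℕ → ℝ} (hf : L f) (f0 : ∀ x, 0 ≤ f x)
    (hs : ∀ a, Summable fun i => f (a, i)) : L (fun a => ∑' i, f (a, i)) := by
  have h1 : RE fun x : ((α × (ℕ × ℕ × ℕ)) × List (ℕ × ℕ × ℕ)) × ℕ =>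
      Qv (x.1.2.getD x.2 (0, 0, 0)) < f (x.1.1.1, x.2) := by
    refine (hf.comp (Primrec.pair (Primrec.fst.comp (Primrec.fst.comp Primrec.fst))
      Primrec.snd)).lt (RC.val ?_)
    exact (Primrec.list_getD _).comp (Primrec.snd.comp Primrec.fst) Primrec.snd
  have h2 : RE fun x : (α × (ℕ × ℕ × ℕ)) × List (ℕ × ℕ × ℕ) =>
      ∀ i < x.2.length, Qv (x.2.getD i (0, 0, 0)) < f (x.1.1, i) :=
    (RE.forall_lt h1).comp (Primrec.pair Primrec.id (Primrec.list_length.comp Primrec.snd))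
  have h3 : RE fun x : (α × (ℕ × ℕ × ℕ)) × List (ℕ × ℕ × ℕ) => Qv x.1.2 < (x.2.map Qv).sum :=
    RC.lt (RC.val (Primrec.snd.comp Primrec.fst)) (RC.list_sum Primrec.snd)
  refine (RE.ex (h2.and h3)).of_eq fun x => ?_
  have sumeq : ∀ l : List (ℕ × ℕ × ℕ), (l.map Qv).sum =
      ∑ i ∈ Finset.range l.length, Qv (l.getD i (0, 0, 0)) := by
    intro l
    induction l with
    | nil => simp
    | cons y l ih => simp [Finset.sum_range_succ', ih, add_comm]
  constructor
  · intro h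
    obtain ⟨N, hN⟩ := ((hs x.1).hasSum.tendsto_sum_nat.eventually_const_lt h).exists
    set δ := (∑ i ∈ Finset.range N, f (x.1, i) - Qv x.2) / (N + 1) with hδ
    have hpos : 0 < δ := by apply div_pos <;> [linarith; positivity]
    choose t ht ht' using fun i => Qv_between (show f (x.1, i) - δ < f (x.1, i) by linarith)
    have hget : ∀ i < N, ((List.range N).map t).getD i (0, 0, 0) = t i := by
      intro i hi
      simp [List.getD, hi]
    refine ⟨(List.range N).map t, ?_, ?_⟩
    · intro i hi
      simp only [List.length_map, List.length_range] at hi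
      simp only [hget i hi]
      exact ht' i
    · simp only [sumeq, List.length_map, List.length_range]
      rw [Finset.sum_congr rfl fun i hi => by rw [hget i (Finset.mem_range.1 hi)]]
      have h5 : ∑ i ∈ Finset.range N, (f (x.1, i) - δ) ≤ ∑ i ∈ Finset.range N, Qv (t i) :=
        Finset.sum_le_sum fun i _ => (ht i).le
      rw [Finset.sum_sub_distrib, Finset.sum_const, Finset.card_range, nsmul_eq_mul] at h5
      have h6 : (N + 1) * δ = ∑ i ∈ Finset.range N, f (x.1, i) - Qv x.2 := by
        rw [hδ]; field_simp
      linarith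
  · rintro ⟨l, h1, h2⟩
    simp only [sumeq] at h1 h2 ⊢
    have h3 := Finset.sum_le_sum fun i (hi : i ∈ Finset.range l.length) =>
      (h1 i (Finset.mem_range.1 hi)).le
    have h4 := (hs x.1).sum_le_tsum (Finset.range l.length) (fun i _ => f0 _)
    linarith

end RC

/-! ### The coding of rationals and computable reals -/

def oldEnc (q : ℚ) : ℕ := Nat.pair (Equiv.intEquivNat q.num) q.den

def ratOK (m : ℕ) : Prop := 0 < m.unpair.2 ∧ ((m.unpair.1 + 1) / 2).Coprime m.unpair.2

theorem intEnc_val (z : ℤ) : (z : ℝ) =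
    (-1) ^ (Equiv.intEquivNat z) * (((Equiv.intEquivNat z + 1) / 2 : ℕ) : ℝ) := by
  cases z with
  | ofNat n =>
    have : Equiv.intEquivNat (Int.ofNat n) = 2 * n := rfl
    have h2 : (2 * n + 1) / 2 = n := by omega
    rw [this, h2, pow_mul]; simp
  | negSucc n =>
    have : Equiv.intEquivNat (Int.negSucc n) = 2 * n + 1 := rfl
    have h2 : (2 * n + 1 + 1) / 2 = n + 1 := by omega
    rw [this, h2, pow_succ, pow_mul, Int.cast_negSucc]; simp

theorem intEnc_natAbs (z : ℤ) : (Equiv.intEquivNat z + 1) / 2 = z.natAbs := by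
  cases z with
  | ofNat n =>
    have : Equiv.intEquivNat (Int.ofNat n) = 2 * n := rfl
    rw [this]; simp only [Int.ofNat_eq_natCast, Int.natAbs_natCast]; omega
  | negSucc n =>
    have : Equiv.intEquivNat (Int.negSucc n) = 2 * n + 1 := rfl
    rw [this, Int.natAbs_negSucc]; omega

theorem range_oldEnc (m : ℕ) : m ∈ Set.range oldEnc ↔ ratOK m := by
  constructor
  · rintro ⟨q, rfl⟩
    simp only [oldEnc, ratOK, Nat.unpair_pair, intEnc_natAbs]
    exact ⟨q.den_pos, q.reduced⟩
  · rintro ⟨h1, h2⟩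
    have h3 : Equiv.intEquivNat (Equiv.intEquivNat.symm m.unpair.1) = m.unpair.1 := by simp
    rw [← h3, intEnc_natAbs] at h2
    refine ⟨⟨Equiv.intEquivNat.symm m.unpair.1, m.unpair.2, h1.ne', h2⟩, ?_⟩
    simp [oldEnc]

open Classical in
theorem encode_rat (q : ℚ) : @encode ℚ (@Primcodable.toEncodable ℚ _) q =
    ((List.range (oldEnc q)).filter (fun m => ratOK m)).length := by
  have : @encode ℚ (@Primcodable.toEncodable ℚ _) q = @List.countP ℕ (fun m => @decide
    (m ∈ Set.range (@encode ℚ (Rat.instEncodable))) (Encodable.decidableRangeEncode ℚ m))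
    (List.range (oldEnc q)) := rfl
  rw [this, List.countP_eq_length_filter]
  congr 2
  funext m
  have h : m ∈ Set.range (@encode ℚ (Rat.instEncodable)) ↔ ratOK m := range_oldEnc m
  simp only [h]

open Primrec in
theorem primrec_ratOK : PrimrecPred ratOK := by
  have a : Primrec fun x : ℕ × ℕ => (x.2.unpair.1 + 1) / 2 :=
    nat_div.comp (succ.comp (fst.comp (unpair.comp snd))) (const 2)
  have d : Primrec fun x : ℕ × ℕ => x.2.unpair.2 := snd.comp (unpair.comp snd)
  have h1 : PrimrecRel fun (k m : ℕ) => ¬ (2 ≤ k ∧ (m.unpair.1 + 1) / 2 % k = 0 ∧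
      m.unpair.2 % k = 0) := by
    refine PrimrecPred.not ((PrimrecRel.comp nat_le (const 2) fst).and
      ((PrimrecRel.comp Primrec.eq (nat_mod.comp a fst) (const 0)).and
      (PrimrecRel.comp Primrec.eq (nat_mod.comp d fst) (const 0))))
  have h2 := PrimrecRel.comp (PrimrecRel.forall_mem_list h1)
    (list_range.comp (succ.comp (snd.comp unpair))) Primrec.id
  have h3 := PrimrecRel.comp nat_lt (const 0) (snd.comp unpair)
  refine (h3.and h2).of_eq fun m => ?_
  simp only [ratOK, List.mem_range, id]
  refine and_congr_right fun h0 => ?_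
  constructor
  · intro H
    by_contra hc
    obtain ⟨p, hp, hpa, hpb⟩ := Nat.Prime.not_coprime_iff_dvd.1 hc
    exact H p (Nat.lt_succ_of_le (Nat.le_of_dvd h0 hpb)) ⟨hp.two_le, Nat.mod_eq_zero_of_dvd hpa,
      Nat.mod_eq_zero_of_dvd hpb⟩
  · rintro H k - ⟨hk, ha, hb⟩
    have := Nat.dvd_gcd (Nat.dvd_of_mod_eq_zero ha) (Nat.dvd_of_mod_eq_zero hb)
    rw [H] at this
    have := Nat.le_of_dvd one_pos this
    omega

open Primrec in
theorem RE_rat : RE (fun x : (ℕ × ℕ × ℕ) × ℚ => (x.2 : ℝ) = Qv x.1) := by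
  classical
  have m : Primrec fun y : ((ℕ × ℕ × ℕ) × ℚ) × ℕ => y.2 := snd
  have i : Primrec fun y : ((ℕ × ℕ × ℕ) × ℚ) × ℕ => y.2.unpair.1 := fst.comp (unpair.comp m)
  have d : Primrec fun y : ((ℕ × ℕ × ℕ) × ℚ) × ℕ => y.2.unpair.2 := snd.comp (unpair.comp m)
  have h1 : RE fun y : ((ℕ × ℕ × ℕ) × ℚ) × ℕ => ratOK y.2 := RE.of_prim (primrec_ratOK.comp m)
  have h2 : RE fun y : ((ℕ × ℕ × ℕ) × ℚ) × ℕ =>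
      ((List.range y.2).filter (fun m => ratOK m)).length =
        @encode ℚ (@Primcodable.toEncodable ℚ _) y.1.2 :=
    RE.of_prim (PrimrecRel.comp Primrec.eq (list_length.comp
      ((Primrec.listFilter primrec_ratOK).comp (list_range.comp m)))
      (Primrec.encode.comp (snd.comp fst)))
  have h3 : RE fun y : ((ℕ × ℕ × ℕ) × ℚ) × ℕ => Qv y.1.1 * (y.2.unpair.2 : ℝ) =
      (-1) ^ y.2.unpair.1 * (((y.2.unpair.1 + 1) / 2 : ℕ) : ℝ) :=
    RC.eq ((RC.val (fst.comp fst)).mul (RC.nat d))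
      ((RC.one.neg.pow i).mul (RC.nat (nat_div.comp (succ.comp i) (const 2))))
  refine (RE.ex (h1.and (h2.and h3))).of_eq fun x => ?_
  have hd : ∀ q : ℚ, (q : ℝ) * q.den = q.num := by
    intro q
    exact_mod_cast Rat.mul_den_eq_num q
  constructor
  · intro h
    refine ⟨oldEnc x.2, (range_oldEnc _).1 ⟨_, rfl⟩, (encode_rat _).symm, ?_⟩
    simp only [oldEnc, Nat.unpair_pair, ← intEnc_val]
    rw [← h, hd]
  · rintro ⟨m, h1, h2, h3⟩
    obtain ⟨q, rfl⟩ := (range_oldEnc _).2 h1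
    rw [← encode_rat] at h2
    have hq : q = x.2 := (@encode_injective ℚ (@Primcodable.toEncodable ℚ _)) h2
    subst hq
    simp only [oldEnc, Nat.unpair_pair, ← intEnc_val] at h3
    rw [← hd] at h3
    have : (x.2.den : ℝ) ≠ 0 := by exact_mod_cast x.2.den_ne_zero
    exact (mul_right_cancel₀ this h3).symm

theorem inv_nat_small {ε : ℝ} (h : 0 < ε) : ∃ n : ℕ, 2 * (1 / ((n : ℝ) + 1)) < ε := by
  obtain ⟨n, hn⟩ := exists_nat_one_div_lt (half_pos h)
  exact ⟨n, by linarith⟩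

open Primrec in
theorem computableReal_iff (x : ℝ) :
    ComputableReal x ↔ L (fun _ : Unit => x) ∧ L (fun _ : Unit => - x) := by
  constructor
  · rintro ⟨f, hf, hx⟩
    have hx' : ∀ n : ℕ, |x - f (n + 1)| < 1 / ((n : ℝ) + 1) := fun n => by
      have := hx (n + 1) n.succ_pos
      push_cast at this
      exact this
    have h1 : RE fun y : (Unit × (ℕ × ℕ × ℕ)) × (ℕ × (ℕ × ℕ × ℕ)) =>
        ((f (y.2.1 + 1) : ℚ) : ℝ) = Qv y.2.2 :=
      RE_rat.comp_computable (f := fun y : (Unit × (ℕ × ℕ × ℕ)) × (ℕ × (ℕ × ℕ × ℕ)) =>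
        (y.2.2, f (y.2.1 + 1)))
        (Computable.pair (snd.comp snd).to_comp (hf.comp (succ.comp (fst.comp snd)).to_comp))
    constructor
    · have h2 : RE fun y : (Unit × (ℕ × ℕ × ℕ)) × (ℕ × (ℕ × ℕ × ℕ)) =>
          Qv y.1.2 + 1 / ((y.2.1 : ℝ) + 1) < Qv y.2.2 :=
        RC.lt ((RC.val (snd.comp fst)).add (RC.inv_succ (fst.comp snd))) (RC.val (snd.comp snd))
      refine (RE.ex (h1.and h2)).of_eq fun y => ?_
      constructor
      · intro h
        obtain ⟨n, hn⟩ := inv_nat_small (sub_pos.2 h)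
        obtain ⟨t, ht⟩ := Qv_surj (f (n + 1))
        refine ⟨(n, t), ht.symm, ?_⟩
        have := abs_lt.1 (hx' n)
        simp only [ht]
        linarith
      · rintro ⟨⟨n, t⟩, h1, h2⟩
        simp only at h1 h2
        have := abs_lt.1 (hx' n)
        simp only
        linarith
    · have h2 : RE fun y : (Unit × (ℕ × ℕ × ℕ)) × (ℕ × (ℕ × ℕ × ℕ)) =>
          Qv y.1.2 + 1 / ((y.2.1 : ℝ) + 1) < - Qv y.2.2 :=
        RC.lt ((RC.val (snd.comp fst)).add (RC.inv_succ (fst.comp snd))) (RC.val (snd.comp snd)).neg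
      refine (RE.ex (h1.and h2)).of_eq fun y => ?_
      constructor
      · intro h
        obtain ⟨n, hn⟩ := inv_nat_small (sub_pos.2 h)
        obtain ⟨t, ht⟩ := Qv_surj (f (n + 1))
        refine ⟨(n, t), ht.symm, ?_⟩
        have := abs_lt.1 (hx' n)
        simp only [ht]
        linarith
      · rintro ⟨⟨n, t⟩, h1, h2⟩
        simp only at h1 h2
        have := abs_lt.1 (hx' n)
        simp only
        linarith
  · rintro ⟨hl, hu⟩
    have h1 : RE fun y : (ℕ × ℚ) × (ℕ × ℕ × ℕ) => (y.1.2 : ℝ) = Qv y.2 :=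
      RE_rat.comp (pair snd (snd.comp fst))
    have h2 : RE fun y : (ℕ × ℚ) × (ℕ × ℕ × ℕ) => Qv y.2 - 1 / ((y.1.1 : ℝ) + 1) < x :=
      (hl.comp (const ())).lt ((RC.val snd).sub (RC.inv_succ (fst.comp fst)))
    have h3 : RE fun y : (ℕ × ℚ) × (ℕ × ℕ × ℕ) => - Qv y.2 - 1 / ((y.1.1 : ℝ) + 1) < - x :=
      (hu.comp (const ())).lt ((RC.val snd).neg.sub (RC.inv_succ (fst.comp fst)))
    obtain ⟨f, hf, hP⟩ := RE.choose (RE.ex (h1.and (h2.and h3))) (fun n => by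
      obtain ⟨q, hq, hq'⟩ := exists_rat_btwn (show x < x + 1 / ((n : ℝ) + 1) by
        have : 0 < 1 / ((n : ℝ) + 1) := by positivity
        linarith)
      obtain ⟨t, ht⟩ := Qv_surj q
      refine ⟨q, t, ht.symm, ?_, ?_⟩
      · simp only [ht]; linarith
      · have : 0 < 1 / ((n : ℝ) + 1) := by positivity
        simp only [ht]; linarith)
    refine ⟨f, hf, fun n hn => ?_⟩
    obtain ⟨t, h1, h2, h3⟩ := hP n
    simp only at h1 h2 h3
    have h4 : 1 / ((n : ℝ) + 1) < 1 / n := by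
      apply one_div_lt_one_div_of_lt
      · exact_mod_cast hn
      · linarith
    rw [h1, abs_lt]
    constructor <;> linarith

/-! ### Analysis of the thermodynamic quantities -/

theorem prefixFree_uniquelyDecodable {S : Set (List Bool)} (h : PrefixFree S) (h0 : [] ∉ S) :
    InformationTheory.UniquelyDecodable S := by
  intro L₁
  induction L₁ with
  | nil =>
    intro L₂ _ h2 he
    cases L₂ with
    | nil => rfl
    | cons w l =>
      simp only [List.flatten_nil, List.flatten_cons] at he
      have : w = [] := (List.append_eq_nil_iff.1 he.symm).1
      exact absurd (this ▸ h2 w (by simp)) h0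
  | cons v l ih =>
    intro L₂ h1 h2 he
    cases L₂ with
    | nil =>
      simp only [List.flatten_nil, List.flatten_cons] at he
      have : v = [] := (List.append_eq_nil_iff.1 he).1
      exact absurd (this ▸ h1 v (by simp)) h0
    | cons w l' =>
      simp only [List.flatten_cons] at he
      have hv := h1 v (by simp)
      have hw := h2 w (by simp)
      have hvw : v = w := by
        rcases List.prefix_or_prefix_of_prefix (List.prefix_append v l.flatten)
          (he ▸ List.prefix_append w l'.flatten) with h' | h'
        · exact h v hv w hw h'
        · exact (h w hw v hv h').symm
      subst hvw
      rw [ih l' (fun x hx => h1 x (by simp [hx])) (fun x hx => h2 x (by simp [hx]))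
        (List.append_cancel_left he)]

theorem HasSum.congr_of_eq {ι : Type} {f g : ι → ℝ} {a : ℝ} (hf : HasSum f a)
    (h : ∀ i, g i = f i) : HasSum g a := by
  rwa [show g = f from funext h]

theorem boltzmann_pos (T : ℝ) (p : List Bool) : 0 < boltzmann T p := by
  unfold boltzmann; positivity

theorem boltzmann_one (p : List Bool) : boltzmann 1 p = (1 / 2) ^ p.length := by
  rw [boltzmann, div_one, Real.rpow_neg two_pos.le, Real.rpow_natCast, one_div, inv_pow]

theorem nil_not_mem {C : Computer} (hpr : PhysicallyReasonable C) : [] ∉ C.f.Dom := by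
  intro h
  obtain ⟨p, hp, q, hq, hne⟩ := hpr
  have h1 := C.dom_prefixFree _ h p hp (List.nil_prefix)
  have h2 := C.dom_prefixFree _ h q hq (List.nil_prefix)
  exact hne (by rw [← h1, ← h2])

theorem summable_one {C : Computer} (hpr : PhysicallyReasonable C) :
    Summable fun p : C.f.Dom => boltzmann 1 p.1 := by
  refine summable_of_sum_le (c := 1) (fun p => (boltzmann_pos _ _).le) fun u => ?_
  have hud := prefixFree_uniquelyDecodable C.dom_prefixFree (nil_not_mem hpr)
  have h1 := InformationTheory.kraft_mcmillan_inequality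
    (S := u.map (Function.Embedding.subtype _)) (by
      intro L₁ L₂ h1 h2 he
      refine hud L₁ L₂ (fun w hw => ?_) (fun w hw => ?_) he
      · have := h1 w hw
        simp only [Finset.coe_map, Set.mem_image] at this
        obtain ⟨x, _, rfl⟩ := this
        exact x.2
      · have := h2 w hw
        simp only [Finset.coe_map, Set.mem_image] at this
        obtain ⟨x, _, rfl⟩ := this
        exact x.2)
  rw [Finset.sum_map] at h1
  refine le_trans (le_of_eq ?_) h1
  refine Finset.sum_congr rfl fun x _ => ?_
  rw [boltzmann_one]
  simp

theorem boltzmann_mono {T T' : ℝ} (h : 0 < T) (h' : T ≤ T') (p : List Bool) :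
    boltzmann T p ≤ boltzmann T' p := by
  unfold boltzmann
  apply Real.rpow_le_rpow_of_exponent_le one_le_two
  rw [neg_div, neg_div, neg_le_neg_iff]
  exact div_le_div_of_nonneg_left (by positivity) h h'

theorem boltzmann_strictMono {T T' : ℝ} (h : 0 < T) (h' : T < T') {p : List Bool} (hp : p ≠ []) :
    boltzmann T p < boltzmann T' p := by
  unfold boltzmann
  apply Real.rpow_lt_rpow_of_exponent_lt one_lt_two
  rw [neg_div, neg_div, neg_lt_neg_iff]
  have : 0 < (p.length : ℝ) := by exact_mod_cast List.length_pos_iff.2 hp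
  exact div_lt_div_of_pos_left this h h'

theorem self_le_two_rpow (y : ℝ) : y ≤ 2 ^ y := by
  rcases le_total y 0 with h | h
  · exact h.trans (by positivity)
  rcases le_total y 1 with h1 | h1
  · exact h1.trans (Real.one_le_rpow one_le_two h)
  · have := one_add_mul_self_le_rpow_one_add (show (-1 : ℝ) ≤ 1 by norm_num) h1
    norm_num at this
    linarith

theorem length_mul_boltzmann_le {T : ℝ} (hT : T ∈ Set.Ioo (0 : ℝ) 1) (p : List Bool) :
    (p.length : ℝ) * boltzmann T p ≤ T / (1 - T) * boltzmann 1 p := by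
  have h0 := hT.1
  have h1 : 0 < 1 - T := sub_pos.2 hT.2
  have hK : 0 < T / (1 - T) := div_pos h0 h1
  have e : boltzmann 1 p = boltzmann T p * 2 ^ ((p.length : ℝ) / (T / (1 - T))) := by
    unfold boltzmann
    rw [← Real.rpow_add two_pos]
    congr 1
    field_simp
    ring
  rw [e]
  have := self_le_two_rpow ((p.length : ℝ) / (T / (1 - T)))
  rw [div_le_iff₀ hK] at this
  nlinarith [boltzmann_pos T p]

noncomputable def Wfun (C : Computer) (T : ℝ) : ℝ :=
  ∑' p : C.f.Dom, (p.1.length : ℝ) * boltzmann T p.1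


theorem summable_Z {C : Computer} (hpr : PhysicallyReasonable C) {T : ℝ} (hT : T ∈ Set.Ioo (0 : ℝ) 1) :
    Summable fun p : C.f.Dom => boltzmann T p.1 :=
  (summable_one hpr).of_nonneg_of_le (fun _ => (boltzmann_pos _ _).le)
    fun p => boltzmann_mono hT.1 hT.2.le p.1

theorem summable_W {C : Computer} (hpr : PhysicallyReasonable C) {T : ℝ} (hT : T ∈ Set.Ioo (0 : ℝ) 1) :
    Summable fun p : C.f.Dom => (p.1.length : ℝ) * boltzmann T p.1 :=
  ((summable_one hpr).mul_left (T / (1 - T))).of_nonneg_of_le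
    (fun _ => mul_nonneg (Nat.cast_nonneg _) (boltzmann_pos _ _).le)
    fun p => length_mul_boltzmann_le hT p.1

theorem Z_pos {C : Computer} (hpr : PhysicallyReasonable C) {T : ℝ} (hT : T ∈ Set.Ioo (0 : ℝ) 1) : 0 < Zfun C T := by
  obtain ⟨p, hp, -⟩ := id hpr
  exact (summable_Z hpr hT).tsum_pos (fun _ => (boltzmann_pos _ _).le) ⟨p, hp⟩ (boltzmann_pos _ _)

theorem W_pos {C : Computer} (hpr : PhysicallyReasonable C) {T : ℝ} (hT : T ∈ Set.Ioo (0 : ℝ) 1) : 0 < Wfun C T := by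
  obtain ⟨p, hp, -⟩ := id hpr
  refine (summable_W hpr hT).tsum_pos (fun _ => mul_nonneg (Nat.cast_nonneg _)
    (boltzmann_pos _ _).le) ⟨p, hp⟩ (mul_pos ?_ (boltzmann_pos _ _))
  have : p ≠ [] := fun h => nil_not_mem hpr (h ▸ hp)
  exact_mod_cast List.length_pos_iff.2 this

theorem Z_strictMono {C : Computer} (hpr : PhysicallyReasonable C) : StrictMonoOn (Zfun C) (Set.Ioo 0 1) := by
  intro T hT T' hT' h
  obtain ⟨p, hp, -⟩ := id hpr
  have hne : p ≠ [] := fun h => nil_not_mem hpr (h ▸ hp)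
  exact Summable.tsum_lt_tsum (i := ⟨p, hp⟩) (fun p => boltzmann_mono hT.1 h.le p.1)
    (boltzmann_strictMono hT.1 h hne) (summable_Z hpr hT) (summable_Z hpr hT')

theorem gibbs {C : Computer} (hpr : PhysicallyReasonable C) {T T' : ℝ} (hT : T ∈ Set.Ioo (0 : ℝ) 1) (hT' : T' ∈ Set.Ioo (0 : ℝ) 1)
    (hne : T ≠ T') :
    Real.logb 2 (Zfun C T) - (1 / T' - 1 / T) * Efun C T < Real.logb 2 (Zfun C T') := by
  set δ := 1 / T' - 1 / T with hδ
  set E := Efun C T with hE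
  have hZ := Z_pos hpr hT
  have hEZ : Wfun C T = E * Zfun C T := by
    rw [hE, Efun, Wfun]; field_simp
  have hδ0 : δ ≠ 0 := by
    intro h
    apply hne
    have := sub_eq_zero.1 h
    simpa using this.symm
  have key : ∀ p : List Bool, boltzmann T' p =
      2 ^ (-δ * E) * (boltzmann T p * Real.exp (- (δ * Real.log 2 * (p.length - E)))) := by
    intro p
    have : Real.exp (- (δ * Real.log 2 * (p.length - E))) = 2 ^ (-δ * (p.length - E)) := by
      rw [Real.rpow_def_of_pos two_pos]; congr 1; ring
    rw [this, boltzmann, boltzmann, ← Real.rpow_add two_pos, ← Real.rpow_add two_pos]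
    congr 1
    have h1 := hT.1.ne'
    have h2 := hT'.1.ne'
    rw [hδ]
    field_simp
    ring
  have hs : HasSum (fun p : C.f.Dom => 2 ^ (-δ * E) * (boltzmann T p.1 *
      (- (δ * Real.log 2 * (p.1.length - E)) + 1))) (2 ^ (-δ * E) * Zfun C T) := by
    have h1 := (summable_Z hpr hT).hasSum
    have h2 := (summable_W hpr hT).hasSum
    have h3 := (((h2.sub (h1.mul_left E)).mul_left (-(δ * Real.log 2))).add h1).mul_left
      ((2 : ℝ) ^ (-δ * E))
    have e : (2 : ℝ) ^ (-δ * E) * Zfun C T = 2 ^ (-δ * E) * (-(δ * Real.log 2) *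
        (Wfun C T - E * Zfun C T) + Zfun C T) := by rw [hEZ]; ring
    rw [e]
    refine HasSum.congr_of_eq h3 fun p => ?_
    ring
  have hx : ∃ p ∈ C.f.Dom, (p.length : ℝ) ≠ E := by
    obtain ⟨p, hp, q, hq, h⟩ := hpr
    by_contra! hc
    exact h (by exact_mod_cast (hc p hp).trans (hc q hq).symm)
  obtain ⟨p, hp, hpE⟩ := hx
  have h2 : 0 < (2 : ℝ) ^ (-δ * E) := by positivity
  have hlt : 2 ^ (-δ * E) * Zfun C T < Zfun C T' := by
    refine hasSum_lt (i := ⟨p, hp⟩) (fun p => ?_) ?_ hs (summable_Z hpr hT').hasSum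
    · simp only [key p.1]
      exact mul_le_mul_of_nonneg_left (mul_le_mul_of_nonneg_left (Real.add_one_le_exp _)
        (boltzmann_pos _ _).le) h2.le
    · simp only [key p]
      refine mul_lt_mul_of_pos_left (mul_lt_mul_of_pos_left (Real.add_one_lt_exp ?_)
        (boltzmann_pos _ _)) h2
      exact neg_ne_zero.2 (mul_ne_zero (mul_ne_zero hδ0 (Real.log_pos one_lt_two).ne')
        (sub_ne_zero.2 hpE))
  have := Real.logb_lt_logb one_lt_two (mul_pos h2 hZ) hlt
  rw [Real.logb_mul h2.ne' hZ.ne', Real.logb_rpow two_pos (by norm_num)] at this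
  linarith

theorem E_strictMono {C : Computer} (hpr : PhysicallyReasonable C) : StrictMonoOn (Efun C) (Set.Ioo 0 1) := by
  intro T hT T' hT' h
  have h1 := gibbs hpr hT hT' h.ne
  have h2 := gibbs hpr hT' hT h.ne'
  have h3 : 1 / T' < 1 / T := one_div_lt_one_div_of_lt hT.1 h
  nlinarith

theorem Sfun_eq {C : Computer} {T : ℝ} (hT : T ∈ Set.Ioo (0 : ℝ) 1) :
    Sfun C T = 1 / T * Efun C T + Real.logb 2 (Zfun C T) := by
  have := hT.1.ne'
  rw [Sfun, Ffun]; field_simp; ring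

theorem S_strictMono {C : Computer} (hpr : PhysicallyReasonable C) : StrictMonoOn (Sfun C) (Set.Ioo 0 1) := by
  intro T hT T' hT' h
  have h1 := gibbs hpr hT hT' h.ne
  have h2 := E_strictMono hpr hT hT' h
  rw [Sfun_eq hT, Sfun_eq hT']
  have h3 : 0 < 1 / T' := one_div_pos.2 hT'.1
  nlinarith

theorem S_pos {C : Computer} (hpr : PhysicallyReasonable C) {T : ℝ} (hT : T ∈ Set.Ioo (0 : ℝ) 1) : 0 < Sfun C T := by
  have hZ := Z_pos hpr hT
  obtain ⟨q, hq, hmin⟩ : ∃ q ∈ C.f.Dom, ∀ p ∈ C.f.Dom, q.length ≤ p.length := by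
    obtain ⟨q, hq, h⟩ := WellFounded.has_min (measure (List.length (α := Bool))).wf C.f.Dom
      C.dom_nonempty
    exact ⟨q, hq, fun p hp => not_lt.1 (h p hp)⟩
  obtain ⟨p, hp, hpq⟩ : ∃ p ∈ C.f.Dom, p ≠ q := by
    obtain ⟨p, hp, p', hp', h⟩ := hpr
    by_contra! hc
    exact h (by rw [hc p hp, hc p' hp'])
  have h1 : boltzmann T q < Zfun C T := by
    have hh := (summable_Z hpr hT).sum_le_tsum {⟨q, hq⟩, ⟨p, hp⟩} 
      (fun _ _ => (boltzmann_pos _ _).le)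
    rw [Finset.sum_pair (by simpa using hpq.symm)] at hh
    have := boltzmann_pos T p
    simp only at hh
    unfold Zfun
    linarith
  have h2 : q.length ≤ Efun C T := by
    have : (q.length : ℝ) * Zfun C T ≤ Wfun C T := by
      unfold Zfun Wfun
      rw [← tsum_mul_left]
      refine Summable.tsum_le_tsum (fun p => ?_) ((summable_Z hpr hT).mul_left _)
        (summable_W hpr hT)
      exact mul_le_mul_of_nonneg_right (by exact_mod_cast hmin p.1 p.2) (boltzmann_pos _ _).le
    have e : Efun C T = Wfun C T / Zfun C T := by rw [Efun, Wfun]; field_simp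
    rw [e, le_div_iff₀ hZ]
    exact this
  have h3 := Real.logb_lt_logb one_lt_two (boltzmann_pos T q) h1
  rw [boltzmann, Real.logb_rpow two_pos (by norm_num)] at h3
  rw [Sfun_eq hT]
  have h4 : 0 < 1 / T := one_div_pos.2 hT.1
  have h5 : -(q.length : ℝ) / T = - (1 / T * q.length) := by ring
  nlinarith

theorem F_strictAnti {C : Computer} (hpr : PhysicallyReasonable C) : StrictAntiOn (Ffun C) (Set.Ioo 0 1) := by
  intro T hT T' hT' h
  have h1 := gibbs hpr hT hT' h.ne
  have h2 := S_pos hpr hT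
  rw [Sfun_eq hT] at h2
  have h3 := mul_lt_mul_of_pos_left h1 hT'.1
  have e : T' * (Real.logb 2 (Zfun C T) - (1 / T' - 1 / T) * Efun C T) =
    T * Real.logb 2 (Zfun C T) + (T' - T) * (1 / T * Efun C T + Real.logb 2 (Zfun C T)) := by
    have := hT.1.ne'
    have := hT'.1.ne'
    field_simp
    ring
  have h4 := mul_pos (sub_pos.2 h) h2
  unfold Ffun
  linarith

theorem boltzmann_cont (p : List Bool) : ContinuousOn (fun T => boltzmann T p) (Set.Ioi 0) := by
  unfold boltzmann
  refine ContinuousOn.rpow continuousOn_const (continuousOn_const.div continuousOn_id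
    fun x hx => ne_of_gt hx) fun x _ => Or.inl two_ne_zero

theorem Z_cont {C : Computer} (hpr : PhysicallyReasonable C) : ContinuousOn (Zfun C) (Set.Ioo 0 1) := by
  refine continuousOn_tsum (fun p => (boltzmann_cont p.1).mono fun x hx => hx.1)
    (summable_one hpr) fun p T hT => ?_
  rw [Real.norm_of_nonneg (boltzmann_pos _ _).le]
  exact boltzmann_mono hT.1 hT.2.le _

theorem W_cont {C : Computer} (hpr : PhysicallyReasonable C) : ContinuousOn (Wfun C) (Set.Ioo 0 1) := by
  intro T hT
  obtain ⟨b, hb, hb'⟩ := exists_between hT.2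
  have : ContinuousOn (Wfun C) (Set.Ioo 0 b) := by
    refine continuousOn_tsum (fun p => continuousOn_const.mul
      ((boltzmann_cont p.1).mono fun x hx => hx.1))
      (summable_W hpr ⟨hT.1.trans hb, hb'⟩) fun p T hT => ?_
    rw [Real.norm_of_nonneg (mul_nonneg (Nat.cast_nonneg _) (boltzmann_pos _ _).le)]
    exact mul_le_mul_of_nonneg_left (boltzmann_mono hT.1 hT.2.le _) (Nat.cast_nonneg _)
  exact (this.continuousAt (Ioo_mem_nhds hT.1 hb)).continuousWithinAt

theorem E_cont {C : Computer} (hpr : PhysicallyReasonable C) : ContinuousOn (Efun C) (Set.Ioo 0 1) :=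
  ((Z_cont hpr).inv₀ fun _ hT => (Z_pos hpr hT).ne').mul (W_cont hpr)

theorem logZ_cont {C : Computer} (hpr : PhysicallyReasonable C) : ContinuousOn (fun T => Real.logb 2 (Zfun C T)) (Set.Ioo 0 1) := by
  unfold Real.logb
  exact ((Z_cont hpr).log fun _ hT => (Z_pos hpr hT).ne').div_const _

theorem F_cont {C : Computer} (hpr : PhysicallyReasonable C) : ContinuousOn (Ffun C) (Set.Ioo 0 1) :=
  (continuousOn_id.neg).mul (logZ_cont hpr)

theorem S_cont {C : Computer} (hpr : PhysicallyReasonable C) : ContinuousOn (Sfun C) (Set.Ioo 0 1) :=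
  ((E_cont hpr).sub (F_cont hpr)).div continuousOn_id fun _ hT => ne_of_gt hT.1


/-! ### Computability at rational temperatures -/

noncomputable def tau (t : ℕ × ℕ) : ℝ := ((t.1 : ℝ) + 1) / ((t.1 : ℝ) + t.2 + 2)

theorem tau_mem (t : ℕ × ℕ) : tau t ∈ Set.Ioo (0 : ℝ) 1 := by
  unfold tau
  constructor
  · positivity
  · rw [div_lt_one (by positivity)]
    have : (0 : ℝ) ≤ t.2 := Nat.cast_nonneg _
    linarith

theorem tau_between {x y : ℝ} (h : x < y) (hx : 0 ≤ x) (hy : y ≤ 1) :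
    ∃ t, x < tau t ∧ tau t < y := by
  obtain ⟨q, h1, h2⟩ := exists_rat_btwn h
  have q0 : (0 : ℝ) < q := by linarith
  have q1 : (q : ℝ) < 1 := by linarith
  have q0' : 0 < q := by exact_mod_cast q0
  have q1' : q < 1 := by exact_mod_cast q1
  have hn : 0 < q.num := Rat.num_pos.2 q0'
  have hd : q.num < q.den := Rat.num_lt_denom_iff.2 q1'
  refine ⟨(q.num.toNat - 1, q.den - q.num.toNat - 1), ?_⟩
  have : tau (q.num.toNat - 1, q.den - q.num.toNat - 1) = q := by
    unfold tau
    have e1 : ((q.num.toNat - 1 : ℕ) : ℝ) + 1 = q.num := by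
      have : (((q.num.toNat - 1 : ℕ) : ℤ) + 1) = q.num := by omega
      exact_mod_cast this
    have e2 : ((q.num.toNat - 1 : ℕ) : ℝ) + ((q.den - q.num.toNat - 1 : ℕ) : ℝ) + 2 = q.den := by
      have : (q.num.toNat - 1) + (q.den - q.num.toNat - 1) + 2 = q.den := by omega
      exact_mod_cast this
    simp only [e1, e2]
    exact (Rat.cast_def q).symm
  rw [this]
  exact ⟨h1, h2⟩

theorem RC_tau : RC tau := by
  refine ((RC.nat (Primrec.succ.comp Primrec.fst)).mul (RC.inv_succ (α := ℕ × ℕ) (f := fun t => t.1 + t.2 + 1)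
    (Primrec.succ.comp (Primrec.nat_add.comp Primrec.fst Primrec.snd)))).of_eq fun t => ?_
  simp only [tau]
  push_cast
  rw [div_eq_mul_one_div]
  congr 2
  ring

theorem RC_inv_tau : RC (fun t => 1 / tau t) := by
  refine ((RC.nat (f := fun t : ℕ × ℕ => t.1 + t.2 + 2) (Primrec.nat_add.comp (Primrec.nat_add.comp Primrec.fst Primrec.snd)
    (Primrec.const 2))).mul (RC.inv_succ Primrec.fst)).of_eq fun t => ?_
  simp only [tau]
  push_cast
  rw [one_div_div, div_eq_mul_one_div]

theorem RC_tau_ratio : RC (fun t => tau t / (1 - tau t)) := by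
  refine ((RC.nat (Primrec.succ.comp Primrec.fst)).mul (RC.inv_succ Primrec.snd)).of_eq fun t => ?_
  simp only [tau]
  push_cast
  have : (t.1 : ℝ) + t.2 + 2 ≠ 0 := by positivity
  have : (t.2 : ℝ) + 1 ≠ 0 := by positivity
  have h : 1 - ((t.1 : ℝ) + 1) / ((t.1 : ℝ) + t.2 + 2) = ((t.2 : ℝ) + 1) / ((t.1 : ℝ) + t.2 + 2) := by
    field_simp; ring
  rw [h]
  field_simp

open Primrec in
theorem L_boltzmann : L (fun x : (ℕ × ℕ) × List Bool => boltzmann (tau x.1) x.2) ∧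
    L (fun x : (ℕ × ℕ) × List Bool => - boltzmann (tau x.1) x.2) := by
  have m : Primrec fun x : (ℕ × ℕ) × List Bool => x.1.1 := fst.comp fst
  have n : Primrec fun x : (ℕ × ℕ) × List Bool => x.1.2 := snd.comp fst
  have k : Primrec fun x : (ℕ × ℕ) × List Bool => x.2.length := list_length.comp snd
  refine L.root (ρ := fun x => (1 / (((1 : ℕ) : ℝ) + 1)) ^ (x.2.length * (x.1.1 + x.1.2 + 2)))
    (d := fun x => x.1.1)
    (fun _ => boltzmann_pos _ _) ?_ m ?_
  · exact (RC.inv_succ (const 1)).pow (nat_mul.comp k (nat_add.comp (nat_add.comp m n) (const 2)))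
  · intro x
    have h : (1 / (((1 : ℕ) : ℝ) + 1)) = (2 : ℝ) ^ (-1 : ℝ) := by
      rw [Real.rpow_neg_one]; norm_num
    rw [h, boltzmann, ← Real.rpow_mul_natCast two_pos.le, ← Real.rpow_mul_natCast two_pos.le]
    congr 1
    have : (x.1.1 : ℝ) + x.1.2 + 2 ≠ 0 := by positivity
    have : (x.1.1 : ℝ) + 1 ≠ 0 := by positivity
    unfold tau
    push_cast
    field_simp

theorem RC_boltzmann_one {α : Type} [Primcodable α] {g : α → List Bool} (hg : Primrec g) :
    RC (fun a => boltzmann 1 (g a)) := by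
  refine ((RC.inv_succ (Primrec.const 1)).pow (Primrec.list_length.comp hg)).of_eq fun a => ?_
  rw [boltzmann_one]
  norm_num

open Classical in
theorem L.tsum_dom {α : Type} [Primcodable α] (C : Computer) {w : α × List Bool → ℝ} (hw : L w)
    (w0 : ∀ x, 0 ≤ w x) (hs : ∀ a, Summable fun p : C.f.Dom => w (a, p.1)) :
    L (fun a => ∑' p : C.f.Dom, w (a, p.1)) := by
  let v : α × List Bool → ℝ := fun x => if x.2 ∈ C.f.Dom then w x else 0
  let u : α × ℕ → ℝ := fun x => ((decode₂ (List Bool) x.2).map fun p => v (x.1, p)).getD 0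
  have v0 : ∀ x, 0 ≤ v x := fun x => by
    simp only [v]; split_ifs
    · exact w0 _
    · exact le_rfl
  have hv : L v := by
    have h1 : RE fun x : (α × List Bool) × (ℕ × ℕ × ℕ) => Qv x.2 < 0 :=
      RC.lt (RC.val Primrec.snd) RC.zero
    have h2 : RE fun x : (α × List Bool) × (ℕ × ℕ × ℕ) => x.1.2 ∈ C.f.Dom :=
      (RE.dom C.partrec).comp (Primrec.snd.comp Primrec.fst)
    refine (h1.or (h2.and hw)).of_eq fun x => ?_
    simp only [v]
    split_ifs with h
    · have := w0 x.1
      simp only [h, true_and]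
      constructor
      · exact Or.inr
      · rintro (h | h)
        · linarith
        · exact h
    · simp [h]
  have hu : L u := by
    have h1 : RE fun x : (α × ℕ) × (ℕ × ℕ × ℕ) => Qv x.2 < 0 :=
      RC.lt (RC.val Primrec.snd) RC.zero
    have h2 : RE fun x : ((α × ℕ) × (ℕ × ℕ × ℕ)) × List Bool =>
        encode x.2 = x.1.1.2 :=
      RE.of_prim (PrimrecRel.comp Primrec.eq (Primrec.encode.comp Primrec.snd)
        (Primrec.snd.comp (Primrec.fst.comp Primrec.fst)))
    have h3 : RE fun x : ((α × ℕ) × (ℕ × ℕ × ℕ)) × List Bool =>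
        Qv x.1.2 < v (x.1.1.1, x.2) :=
      (hv.comp (Primrec.pair (Primrec.fst.comp (Primrec.fst.comp Primrec.fst)) Primrec.snd)).lt
        (RC.val (Primrec.snd.comp Primrec.fst))
    refine (h1.or (RE.ex (h2.and h3))).of_eq fun x => ?_
    simp only [u, ← mem_decode₂]
    cases hd : decode₂ (List Bool) x.1.2 with
    | none => simp
    | some p =>
      have := v0 (x.1.1, p)
      simp only [Option.map_some, Option.getD_some, Option.mem_def, Option.some.injEq,
        exists_eq_left']
      constructor
      · exact Or.inr
      · rintro (h | h)
        · linarith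
        · exact h
  have u0 : ∀ x, 0 ≤ u x := fun x => by
    simp only [u]
    cases decode₂ (List Bool) x.2 with
    | none => simp
    | some p => simpa using v0 (x.1, p)
  have hsum : ∀ a, HasSum (fun i => u (a, i)) (∑' p : C.f.Dom, w (a, p.1)) := by
    intro a
    have h1 : HasSum (fun p : List Bool => v (a, p)) (∑' p : C.f.Dom, w (a, p.1)) := by
      have h := (hasSum_subtype_iff_indicator (f := fun p => w (a, p)) (s := C.f.Dom)).1
        (hs a).hasSum
      refine HasSum.congr_of_eq h fun p => ?_
      simp only [v, Set.indicator]
    have inj : Function.Injective (encode : List Bool → ℕ) := encode_injective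
    refine (inj.hasSum_iff ?_).1 (HasSum.congr_of_eq h1 fun p => ?_)
    · intro i hi
      simp only [u]
      cases hd : decode₂ (List Bool) i with
      | none => simp
      | some p =>
        exact absurd ⟨p, mem_decode₂.1 hd⟩ hi
    · simp [u]
  exact (L.tsum hu u0 fun a => (hsum a).summable).of_eq fun a => (hsum a).tsum_eq.symm

section LZ
variable {C : Computer}

theorem boltzmann_le_one {T : ℝ} (hT : T ∈ Set.Ioo (0 : ℝ) 1) (p : List Bool) :
    boltzmann T p ≤ boltzmann 1 p := boltzmann_mono hT.1 hT.2.le p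

theorem L_Z (hpr : PhysicallyReasonable C) : L (fun t => Zfun C (tau t)) := by
  have hs : ∀ t, Summable fun p : C.f.Dom => boltzmann (tau t) p.1 :=
    fun t => summable_Z hpr (tau_mem t)
  have h0 : ∀ x : (ℕ × ℕ) × List Bool, 0 ≤ boltzmann (tau x.1) x.2 :=
    fun x => (boltzmann_pos _ _).le
  have h := L.tsum_dom C L_boltzmann.1 h0 hs
  exact h.of_eq fun t => by rw [Zfun]

theorem L_neg_Z (hpr : PhysicallyReasonable C) (hc : ComputableMeasureMachine C) :
    L (fun t => - Zfun C (tau t)) := by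
  have h1 : L (fun _ : ℕ × ℕ => - Zfun C 1) :=
    ((computableReal_iff _).1 hc).2.comp (Primrec.const ())
  have h2 : L (fun x : (ℕ × ℕ) × List Bool => boltzmann 1 x.2 + - boltzmann (tau x.1) x.2) :=
    (RC_boltzmann_one Primrec.snd).L.add L_boltzmann.2
  have h3 := L.tsum_dom C h2 (fun x => by
    have := boltzmann_le_one (tau_mem x.1) x.2
    linarith) fun t => (summable_one hpr).add (summable_Z hpr (tau_mem t)).neg
  refine (h3.add h1).of_eq fun t => ?_
  simp only
  rw [Summable.tsum_add (summable_one hpr) (summable_Z hpr (tau_mem t)).neg, tsum_neg]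
  unfold Zfun
  ring

theorem L_W (hpr : PhysicallyReasonable C) : L (fun t => Wfun C (tau t)) := by
  have h1 : L (fun x : (ℕ × ℕ) × List Bool => (x.2.length : ℝ) * boltzmann (tau x.1) x.2) :=
    L_boltzmann.1.rc_mul (RC.nat (Primrec.list_length.comp Primrec.snd)) fun _ => Nat.cast_nonneg _
  have hs : ∀ t, Summable fun p : C.f.Dom => (p.1.length : ℝ) * boltzmann (tau t) p.1 :=
    fun t => summable_W hpr (tau_mem t)
  have h0 : ∀ x : (ℕ × ℕ) × List Bool, 0 ≤ (x.2.length : ℝ) * boltzmann (tau x.1) x.2 :=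
    fun x => mul_nonneg (Nat.cast_nonneg _) (boltzmann_pos _ _).le
  have h := L.tsum_dom C h1 h0 hs
  exact h.of_eq fun t => by rw [Wfun]

theorem L_neg_W (hpr : PhysicallyReasonable C) (hc : ComputableMeasureMachine C) :
    L (fun t => - Wfun C (tau t)) := by
  have hK : ∀ t, 0 ≤ tau t / (1 - tau t) := fun t =>
    div_nonneg (tau_mem t).1.le (sub_nonneg.2 (tau_mem t).2.le)
  have h1 : L (fun t : ℕ × ℕ => tau t / (1 - tau t) * (- Zfun C 1)) :=
    L.rc_mul (((computableReal_iff _).1 hc).2.comp (Primrec.const ())) RC_tau_ratio hK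
  have h2 : L (fun x : (ℕ × ℕ) × List Bool => tau x.1 / (1 - tau x.1) * boltzmann 1 x.2 +
      x.2.length * (- boltzmann (tau x.1) x.2)) :=
    ((RC_tau_ratio.comp Primrec.fst).mul (RC_boltzmann_one Primrec.snd)).L.add
      (L_boltzmann.2.rc_mul (RC.nat (Primrec.list_length.comp Primrec.snd))
        fun _ => Nat.cast_nonneg _)
  have h2' : L (fun x : (ℕ × ℕ) × List Bool => tau x.1 / (1 - tau x.1) * boltzmann 1 x.2 +
      - (x.2.length * boltzmann (tau x.1) x.2)) := h2.of_eq fun x => by ring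
  have hs := fun t => (summable_one hpr).mul_left (tau t / (1 - tau t))
  have h3 := L.tsum_dom C h2' (fun x => by
    have := length_mul_boltzmann_le (tau_mem x.1) x.2
    linarith) fun t => (hs t).add (summable_W hpr (tau_mem t)).neg
  refine (h3.add h1).of_eq fun t => ?_
  simp only
  rw [Summable.tsum_add (hs t) (summable_W hpr (tau_mem t)).neg, tsum_neg, tsum_mul_left]
  unfold Zfun Wfun
  ring

theorem L_E (hpr : PhysicallyReasonable C) (hc : ComputableMeasureMachine C) :
    L (fun t => Efun C (tau t)) :=
  L.mul_pos (L.inv (L_neg_Z hpr hc) fun t => Z_pos hpr (tau_mem t)) (L_W hpr)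
    (fun t => inv_pos.2 (Z_pos hpr (tau_mem t))) fun t => W_pos hpr (tau_mem t)

theorem L_neg_E (hpr : PhysicallyReasonable C) (hc : ComputableMeasureMachine C) :
    L (fun t => - Efun C (tau t)) := by
  have hZ := fun t => Z_pos hpr (tau_mem t)
  have hW := fun t => W_pos hpr (tau_mem t)
  have h := L.mul_pos (L.inv (L_neg_W hpr hc) hW) (L_Z hpr) (fun t => inv_pos.2 (hW t)) hZ
  refine (L.neg_inv h fun t => mul_pos (inv_pos.2 (hW t)) (hZ t)).of_eq fun t => ?_
  rw [mul_inv, inv_inv, mul_comm]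
  rfl

theorem L_logZ (hpr : PhysicallyReasonable C) :
    L (fun t => Real.logb 2 (Zfun C (tau t))) :=
  L.logb (L_Z hpr) fun t => Z_pos hpr (tau_mem t)

theorem L_neg_logZ (hpr : PhysicallyReasonable C) (hc : ComputableMeasureMachine C) :
    L (fun t => - Real.logb 2 (Zfun C (tau t))) :=
  L.neg_logb (L_neg_Z hpr hc) fun t => Z_pos hpr (tau_mem t)

theorem L_F (hpr : PhysicallyReasonable C) (hc : ComputableMeasureMachine C) :
    L (fun t => Ffun C (tau t)) :=
  ((L_neg_logZ hpr hc).rc_mul RC_tau fun t => (tau_mem t).1.le).of_eq fun t => by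
    rw [Ffun]; ring

theorem L_neg_F (hpr : PhysicallyReasonable C) :
    L (fun t => - Ffun C (tau t)) :=
  ((L_logZ hpr).rc_mul RC_tau fun t => (tau_mem t).1.le).of_eq fun t => by
    rw [Ffun]; ring

theorem L_S (hpr : PhysicallyReasonable C) (hc : ComputableMeasureMachine C) :
    L (fun t => Sfun C (tau t)) :=
  (((L_E hpr hc).rc_mul RC_inv_tau fun t => (one_div_pos.2 (tau_mem t).1).le).add
    (L_logZ hpr)).of_eq fun t => Sfun_eq (tau_mem t)

theorem L_neg_S (hpr : PhysicallyReasonable C) (hc : ComputableMeasureMachine C) :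
    L (fun t => - Sfun C (tau t)) :=
  (((L_neg_E hpr hc).rc_mul RC_inv_tau fun t => (one_div_pos.2 (tau_mem t).1).le).add
    (L_neg_logZ hpr hc)).of_eq fun t => by rw [Sfun_eq (tau_mem t)]; ring

end LZ

/-! ### Transfer along strictly monotone continuous functions -/

theorem computableReal_neg {x : ℝ} : ComputableReal (-x) ↔ ComputableReal x := by
  rw [computableReal_iff, computableReal_iff, neg_neg, and_comm]

open Primrec in
theorem transfer {f : ℝ → ℝ} (hm : StrictMonoOn f (Set.Ioo 0 1))
    (hc : ContinuousOn f (Set.Ioo 0 1)) (h1 : L (fun t => f (tau t)))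
    (h2 : L (fun t => - f (tau t))) {T : ℝ} (hT : T ∈ Set.Ioo (0 : ℝ) 1) :
    ComputableReal T ↔ ComputableReal (f T) := by
  have hcT : ContinuousAt f T := hc.continuousAt (Ioo_mem_nhds hT.1 hT.2)
  rw [computableReal_iff, computableReal_iff]
  constructor
  · rintro ⟨hl, hu⟩
    constructor
    · have a : RE fun x : (Unit × (ℕ × ℕ × ℕ)) × (ℕ × ℕ) => tau x.2 < T :=
        (hl.comp (const ())).lt (RC_tau.comp snd)
      have b : RE fun x : (Unit × (ℕ × ℕ × ℕ)) × (ℕ × ℕ) => Qv x.1.2 < f (tau x.2) :=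
        (h1.comp snd).lt (RC.val (snd.comp fst))
      refine (RE.ex (a.and b)).of_eq fun x => ?_
      constructor
      · intro hq
        have hev : ∀ᶠ y in 𝓝 T, Qv x.2 < f y := hcT.eventually (lt_mem_nhds hq)
        obtain ⟨l, hlT, hl'⟩ := exists_Ioc_subset_of_mem_nhds' hev hT.1
        obtain ⟨t, ht1, ht2⟩ := tau_between hlT.2 hlT.1 hT.2.le
        exact ⟨t, ht2, hl' ⟨ht1, ht2.le⟩⟩
      · rintro ⟨t, ht, hq⟩
        exact lt_trans hq (hm (tau_mem t) hT ht)
    · have a : RE fun x : (Unit × (ℕ × ℕ × ℕ)) × (ℕ × ℕ) => - tau x.2 < - T :=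
        (hu.comp (const ())).lt (RC_tau.neg.comp snd)
      have b : RE fun x : (Unit × (ℕ × ℕ × ℕ)) × (ℕ × ℕ) => Qv x.1.2 < - f (tau x.2) :=
        (h2.comp snd).lt (RC.val (snd.comp fst))
      refine (RE.ex (a.and b)).of_eq fun x => ?_
      constructor
      · intro hq
        have hev : ∀ᶠ y in 𝓝 T, Qv x.2 < - f y := hcT.neg.eventually (lt_mem_nhds hq)
        obtain ⟨r, hrT, hr'⟩ := exists_Ico_subset_of_mem_nhds' hev hT.2
        obtain ⟨t, ht1, ht2⟩ := tau_between hrT.1 hT.1.le hrT.2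
        exact ⟨t, neg_lt_neg ht1, hr' ⟨ht1.le, ht2⟩⟩
      · rintro ⟨t, ht, hq⟩
        exact lt_trans hq (neg_lt_neg (hm hT (tau_mem t) (neg_lt_neg_iff.1 ht)))
  · rintro ⟨hl, hu⟩
    constructor
    · have a : RE fun x : (Unit × (ℕ × ℕ × ℕ)) × ((ℕ × ℕ) × (ℕ × ℕ × ℕ)) =>
          Qv x.1.2 < tau x.2.1 :=
        RC.lt (RC.val (snd.comp fst)) (RC_tau.comp (fst.comp snd))
      have b : RE fun x : (Unit × (ℕ × ℕ × ℕ)) × ((ℕ × ℕ) × (ℕ × ℕ × ℕ)) =>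
          - Qv x.2.2 < - f (tau x.2.1) :=
        (h2.comp (fst.comp snd)).lt (RC.val (snd.comp snd)).neg
      have c : RE fun x : (Unit × (ℕ × ℕ × ℕ)) × ((ℕ × ℕ) × (ℕ × ℕ × ℕ)) =>
          Qv x.2.2 < f T :=
        (hl.comp (const ())).lt (RC.val (snd.comp snd))
      refine (RE.ex (a.and (b.and c))).of_eq fun x => ?_
      constructor
      · intro hq
        obtain ⟨t, ht1, ht2⟩ := tau_between (max_lt hq hT.1) (le_max_right _ _) hT.2.le
        obtain ⟨s, hs1, hs2⟩ := Qv_between (hm (tau_mem t) hT ht2)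
        exact ⟨(t, s), (le_max_left _ _).trans_lt ht1, neg_lt_neg hs1, hs2⟩
      · rintro ⟨⟨t, s⟩, ht, hq, hs⟩
        have : f (tau t) < f T := lt_trans (neg_lt_neg_iff.1 hq) hs
        exact lt_trans ht ((hm.lt_iff_lt (tau_mem t) hT).1 this)
    · have a : RE fun x : (Unit × (ℕ × ℕ × ℕ)) × ((ℕ × ℕ) × (ℕ × ℕ × ℕ)) =>
          Qv x.1.2 < - tau x.2.1 :=
        RC.lt (RC.val (snd.comp fst)) (RC_tau.neg.comp (fst.comp snd))
      have b : RE fun x : (Unit × (ℕ × ℕ × ℕ)) × ((ℕ × ℕ) × (ℕ × ℕ × ℕ)) =>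
          Qv x.2.2 < f (tau x.2.1) :=
        (h1.comp (fst.comp snd)).lt (RC.val (snd.comp snd))
      have c : RE fun x : (Unit × (ℕ × ℕ × ℕ)) × ((ℕ × ℕ) × (ℕ × ℕ × ℕ)) =>
          - Qv x.2.2 < - f T :=
        (hu.comp (const ())).lt (RC.val (snd.comp snd)).neg
      refine (RE.ex (a.and (b.and c))).of_eq fun x => ?_
      constructor
      · intro hq
        have hq' : T < - Qv x.2 := by
          have : Qv x.2 < - T := hq
          linarith
        obtain ⟨t, ht1, ht2⟩ := tau_between (lt_min hq' hT.2) hT.1.le (min_le_right _ _)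
        obtain ⟨s, hs1, hs2⟩ := Qv_between (hm hT (tau_mem t) ht1)
        have := ht2.trans_le (min_le_left _ _)
        exact ⟨(t, s), by simp only; linarith, hs2, neg_lt_neg hs1⟩
      · rintro ⟨⟨t, s⟩, ht, hq, hs⟩
        have : f T < f (tau t) := lt_trans (neg_lt_neg_iff.1 hs) hq
        exact lt_trans ht (neg_lt_neg ((hm.lt_iff_lt hT (tau_mem t)).1 this))

/-- For a physically reasonable computable measure machine `C`
and `T ∈ (0,1)`: `T` is computable ↔ one of `Z_C(T), F_C(T), E_C(T), S_C(T)`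
is computable ↔ all of them are computable. -/
theorem computability_equivalences (C : Computer)
    (hpr : PhysicallyReasonable C) (hcmm : ComputableMeasureMachine C)
    (T : ℝ) (hT : T ∈ Set.Ioo (0 : ℝ) 1) :
    (ComputableReal T ↔
      (ComputableReal (Zfun C T) ∨ ComputableReal (Ffun C T) ∨
        ComputableReal (Efun C T) ∨ ComputableReal (Sfun C T))) ∧
    (ComputableReal T ↔
      (ComputableReal (Zfun C T) ∧ ComputableReal (Ffun C T) ∧
        ComputableReal (Efun C T) ∧ ComputableReal (Sfun C T))) := by
  have hZ := transfer (Z_strictMono hpr) (Z_cont hpr) (L_Z hpr) (L_neg_Z hpr hcmm) hT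
  have hE := transfer (E_strictMono hpr) (E_cont hpr) (L_E hpr hcmm) (L_neg_E hpr hcmm) hT
  have hS := transfer (S_strictMono hpr) (S_cont hpr) (L_S hpr hcmm) (L_neg_S hpr hcmm) hT
  have hF : ComputableReal T ↔ ComputableReal (Ffun C T) := by
    rw [← computableReal_neg (x := Ffun C T)]
    exact transfer (f := fun T => - Ffun C T) (F_strictAnti hpr).neg (F_cont hpr).neg (L_neg_F hpr)
      ((L_F hpr hcmm).of_eq fun t => neg_neg _) hT
  tauto
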